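/- Fix an integer e ≥ 2 and κ = (κ₁, κ₂) ∈ (ℤ/eℤ)². If λ is a restricted bipartition with no normal i-nodes for any i ∈ ℤ/eℤ, then λ is the empty bipartition (∅ | ∅). -/

import Mathlib

namespace Wt3

/-- `f : ℕ → ℕ` (0-indexed: `f r` is the `(r+1)`-th part `λ_{r+1}`) is a partition if it is
weakly decreasing with finitely many nonzero terms. -/
def IsPartition (f : ℕ → ℕ) : Prop :=
  (∀ r, f (r + 1) ≤ f r) ∧ ∃ N, ∀ r, N ≤ r → f r = 0

/-- A bipartition: an ordered pair of partitions, given as `lam : Fin 2 → ℕ → ℕ`. -/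
def IsBipartition (lam : Fin 2 → ℕ → ℕ) : Prop := ∀ a, IsPartition (lam a)

/-- Nodes `(r, c, a)` with 0-indexed row `r`, column `c`, and component `a : Fin 2`. -/
abbrev Node := ℕ × ℕ × Fin 2

/-- The Young diagram of a bipartition: `(r,c,a)` is a node iff `c < λ⁽ᵃ⁾_r` (0-indexed,
corresponding to `c+1 ≤ λ⁽ᵃ⁾_{r+1}` in 1-indexed terms). -/
def Diagram (lam : Fin 2 → ℕ → ℕ) : Set Node := {x | x.2.1 < lam x.2.2 x.1}

/-- A node of `[λ]` is removable if deleting it leaves the Young diagram of a bipartition. -/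
def IsRemovable (lam : Fin 2 → ℕ → ℕ) (x : Node) : Prop :=
  x ∈ Diagram lam ∧ ∃ mu, IsBipartition mu ∧ Diagram mu = Diagram lam \ {x}

/-- A node not in `[λ]` is addable if adding it gives the Young diagram of a bipartition. -/
def IsAddable (lam : Fin 2 → ℕ → ℕ) (x : Node) : Prop :=
  x ∉ Diagram lam ∧ ∃ mu, IsBipartition mu ∧ Diagram mu = Diagram lam ∪ {x}

/-- The residue `c − r + κ_a ∈ ℤ/eℤ` of a node `(r,c,a)` (0-indexing leaves this unchanged). -/
def res (e : ℕ) (κ : Fin 2 → ZMod e) (x : Node) : ZMod e :=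
  (x.2.1 : ZMod e) - (x.1 : ZMod e) + κ x.2.2

/-- `c_i(λ)`: the number of `i`-nodes of `λ`. -/
noncomputable def cnt (e : ℕ) (κ : Fin 2 → ZMod e) (lam : Fin 2 → ℕ → ℕ) (i : ZMod e) : ℕ :=
  Set.ncard {x : Node | x ∈ Diagram lam ∧ res e κ x = i}

/-- The number of removable `i`-nodes of `λ`. -/
noncomputable def remCount (e : ℕ) (κ : Fin 2 → ZMod e) (lam : Fin 2 → ℕ → ℕ) (i : ZMod e) : ℕ :=
  Set.ncard {x : Node | IsRemovable lam x ∧ res e κ x = i}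

/-- The number of addable `i`-nodes of `λ`. -/
noncomputable def addCount (e : ℕ) (κ : Fin 2 → ZMod e) (lam : Fin 2 → ℕ → ℕ) (i : ZMod e) : ℕ :=
  Set.ncard {x : Node | IsAddable lam x ∧ res e κ x = i}

/-- `δ_i(λ)`: number of removable `i`-nodes minus number of addable `i`-nodes. -/
noncomputable def delta (e : ℕ) (κ : Fin 2 → ZMod e) (lam : Fin 2 → ℕ → ℕ) (i : ZMod e) : ℤ :=
  (remCount e κ lam i : ℤ) - (addCount e κ lam i : ℤ)

/-- The weight `wt(λ) = c_{κ₁}(λ) + c_{κ₂}(λ) − ½ Σ_{i ∈ ℤ/eℤ} (c_i(λ) − c_{i+1}(λ))²`. -/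
noncomputable def wt (e : ℕ) (κ : Fin 2 → ZMod e) (lam : Fin 2 → ℕ → ℕ) : ℚ :=
  (cnt e κ lam (κ 0) : ℚ) + (cnt e κ lam (κ 1) : ℚ) -
    (1 / 2) * ∑ j ∈ Finset.range e,
      ((cnt e κ lam (j : ZMod e) : ℚ) - (cnt e κ lam ((j : ZMod e) + 1) : ℚ)) ^ 2

/-- The rim of `λ`: nodes `(r,c,a) ∈ [λ]` with `(r+1,c+1,a) ∉ [λ]`. -/
def Rim (lam : Fin 2 → ℕ → ℕ) : Set Node :=
  {x | x ∈ Diagram lam ∧ (x.1 + 1, x.2.1 + 1, x.2.2) ∉ Diagram lam}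

/-- One step along a strip: `y` is one step to the right of, or one step above, `x`
(in the same component). -/
def Step (x y : Node) : Prop :=
  y.2.2 = x.2.2 ∧ ((y.1 = x.1 ∧ y.2.1 = x.2.1 + 1) ∨ (x.1 = y.1 + 1 ∧ y.2.1 = x.2.1))

/-- A rim hook of `λ`: a nonempty subset of the rim, contained in a single component,
forming a connected strip, whose removal leaves the Young diagram of a bipartition. -/
def IsRimHook (lam : Fin 2 → ℕ → ℕ) (H : Finset Node) : Prop :=
  H.Nonempty ∧ ↑H ⊆ Rim lam ∧ (∀ x ∈ H, ∀ y ∈ H, x.2.2 = y.2.2) ∧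
    (∃ l : List Node, l.Chain' Step ∧ ∀ x : Node, x ∈ l ↔ x ∈ H) ∧
    ∃ mu, IsBipartition mu ∧ Diagram mu = Diagram lam \ ↑H

/-- A bicore: a bipartition with no rim `e`-hooks. -/
def IsBicore (e : ℕ) (lam : Fin 2 → ℕ → ℕ) : Prop :=
  ¬ ∃ H : Finset Node, IsRimHook lam H ∧ H.card = e

/-- The beta-set `{λ_r + k − r : 1 ≤ r ≤ k}` of a partition with charge `k` (0-indexed form). -/
def betaSet (f : ℕ → ℕ) (k : ℕ) : Finset ℕ :=
  (Finset.range k).image fun r => f r + (k - (r + 1))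

/-- The number of nonzero parts of a partition. -/
noncomputable def len (f : ℕ → ℕ) : ℕ := Set.ncard {r : ℕ | f r ≠ 0}

/-- `(k₁,k₂)` is a bicharge for `κ` relative to `λ`. -/
def IsBicharge (e : ℕ) (κ : Fin 2 → ZMod e) (lam : Fin 2 → ℕ → ℕ) (k₁ k₂ : ℕ) : Prop :=
  (k₁ : ZMod e) = κ 0 ∧ (k₂ : ZMod e) = κ 1 ∧ len (lam 0) ≤ k₁ ∧ len (lam 1) ≤ k₂

/-- `γ_x(λ)`: beads of residue `x` in the first beta-set minus those in the second. -/
def gamma (e : ℕ) (lam : Fin 2 → ℕ → ℕ) (k₁ k₂ : ℕ) (x : ZMod e) : ℤ :=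
  (((betaSet (lam 0) k₁).filter fun b : ℕ => (b : ZMod e) = x).card : ℤ) -
    (((betaSet (lam 1) k₂).filter fun b : ℕ => (b : ZMod e) = x).card : ℤ)

/-- `x` is above (higher than) `y`. -/
def Above (x y : Node) : Prop := x.2.2 < y.2.2 ∨ (x.2.2 = y.2.2 ∧ x.1 < y.1)

/-- A normal `i`-node: a removable `i`-node `x` such that for every addable `i`-node `y`
below `x`, the removable `i`-nodes strictly between `x` and `y` outnumber the addable ones
(equivalently, the `−` sign of `x` survives in the reduced `i`-signature). -/
def IsNormal (e : ℕ) (κ : Fin 2 → ZMod e) (lam : Fin 2 → ℕ → ℕ) (i : ZMod e) (x : Node) :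
    Prop :=
  IsRemovable lam x ∧ res e κ x = i ∧
    ∀ y : Node, IsAddable lam y → res e κ y = i → Above x y →
      Set.ncard {z : Node | IsAddable lam z ∧ res e κ z = i ∧ Above x z ∧ Above z y} <
        Set.ncard {z : Node | IsRemovable lam z ∧ res e κ z = i ∧ Above x z ∧ Above z y}

/-- The good `i`-node: the highest normal `i`-node. -/
def IsGood (e : ℕ) (κ : Fin 2 → ZMod e) (lam : Fin 2 → ℕ → ℕ) (i : ZMod e) (x : Node) :
    Prop :=
  IsNormal e κ lam i x ∧ ∀ y, IsNormal e κ lam i y → y = x ∨ Above x y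

/-- An antinormal `i`-node: a removable `i`-node `x` such that for every addable `i`-node `y`
above `x`, the removable `i`-nodes strictly between `y` and `x` outnumber the addable ones
(equivalently, the `−` sign of `x` survives in the antireduced `i`-signature). -/
def IsAntinormal (e : ℕ) (κ : Fin 2 → ZMod e) (lam : Fin 2 → ℕ → ℕ) (i : ZMod e) (x : Node) :
    Prop :=
  IsRemovable lam x ∧ res e κ x = i ∧
    ∀ y : Node, IsAddable lam y → res e κ y = i → Above y x →
      Set.ncard {z : Node | IsAddable lam z ∧ res e κ z = i ∧ Above y z ∧ Above z x} <
        Set.ncard {z : Node | IsRemovable lam z ∧ res e κ z = i ∧ Above y z ∧ Above z x}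

/-- The antigood `i`-node: the lowest antinormal `i`-node. -/
def IsAntigood (e : ℕ) (κ : Fin 2 → ZMod e) (lam : Fin 2 → ℕ → ℕ) (i : ZMod e) (x : Node) :
    Prop :=
  IsAntinormal e κ lam i x ∧ ∀ y, IsAntinormal e κ lam i y → y = x ∨ Above y x

/-- `μ →ᵢ λ`: `μ` is obtained from `λ` by removing the good `i`-node. -/
def RemGoodAt (e : ℕ) (κ : Fin 2 → ZMod e) (i : ZMod e) (mu lam : Fin 2 → ℕ → ℕ) : Prop :=
  ∃ x, IsGood e κ lam i x ∧ Diagram mu = Diagram lam \ {x}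

/-- `μ ⇒ᵢ λ`: `μ` is obtained from `λ` by removing the antigood `i`-node. -/
def RemAntigoodAt (e : ℕ) (κ : Fin 2 → ZMod e) (i : ZMod e) (mu lam : Fin 2 → ℕ → ℕ) : Prop :=
  ∃ x, IsAntigood e κ lam i x ∧ Diagram mu = Diagram lam \ {x}

/-- `μ → λ`: `μ` is obtained from the bipartition `λ` by removing a good node. -/
def RemGood (e : ℕ) (κ : Fin 2 → ZMod e) (mu lam : Fin 2 → ℕ → ℕ) : Prop :=
  IsBipartition mu ∧ IsBipartition lam ∧ ∃ i, RemGoodAt e κ i mu lam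

/-- A bipartition is restricted if it lies in the class of the empty bipartition under the
equivalence relation generated by `→`. -/
def IsRestricted (e : ℕ) (κ : Fin 2 → ZMod e) (lam : Fin 2 → ℕ → ℕ) : Prop :=
  Relation.EqvGen (RemGood e κ) lam (fun _ _ => 0)

/-- A partition is `e`-restricted if `λ_r − λ_{r+1} < e` for all `r`. -/
def IsERestricted (e : ℕ) (f : ℕ → ℕ) : Prop := ∀ r, f r < f (r + 1) + e

/-- The conjugate partition: `λ′_r = #{c : λ_c ≥ r}` (0-indexed form). -/
noncomputable def conjP (f : ℕ → ℕ) : ℕ → ℕ := fun r => Set.ncard {c : ℕ | r + 1 ≤ f c}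

/-- The conjugate bipartition `λ′ = ((λ⁽²⁾)′ | (λ⁽¹⁾)′)`. -/
noncomputable def conjB (lam : Fin 2 → ℕ → ℕ) : Fin 2 → ℕ → ℕ := fun a => conjP (lam (1 - a))

/-- `|λ|` for a partition. -/
noncomputable def psize (f : ℕ → ℕ) : ℕ := Set.ncard {p : ℕ × ℕ | p.2 < f p.1}

/-- `|λ|` for a bipartition. -/
noncomputable def bsize (lam : Fin 2 → ℕ → ℕ) : ℕ := psize (lam 0) + psize (lam 1)

/-- `λ_1 + ⋯ + λ_r`. -/
def psum (f : ℕ → ℕ) (r : ℕ) : ℕ := ∑ j ∈ Finset.range r, f j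

/-- The dominance order on bipartitions: `λ ⊵ μ`. -/
def Dominates (lam mu : Fin 2 → ℕ → ℕ) : Prop :=
  ∀ r : ℕ, psum (mu 0) r ≤ psum (lam 0) r ∧
    psize (mu 0) + psum (mu 1) r ≤ psize (lam 0) + psum (lam 1) r

/-! Single-partition versions (for statement 11). -/

abbrev Node1 := ℕ × ℕ

def Diagram1 (f : ℕ → ℕ) : Set Node1 := {x | x.2 < f x.1}

def IsRemovable1 (f : ℕ → ℕ) (x : Node1) : Prop :=
  x ∈ Diagram1 f ∧ ∃ g, IsPartition g ∧ Diagram1 g = Diagram1 f \ {x}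

def IsAddable1 (f : ℕ → ℕ) (x : Node1) : Prop :=
  x ∉ Diagram1 f ∧ ∃ g, IsPartition g ∧ Diagram1 g = Diagram1 f ∪ {x}

def res1 (e : ℕ) (k : ZMod e) (x : Node1) : ZMod e := (x.2 : ZMod e) - (x.1 : ZMod e) + k

def Rim1 (f : ℕ → ℕ) : Set Node1 := {x | x ∈ Diagram1 f ∧ (x.1 + 1, x.2 + 1) ∉ Diagram1 f}

def Step1 (x y : Node1) : Prop :=
  (y.1 = x.1 ∧ y.2 = x.2 + 1) ∨ (x.1 = y.1 + 1 ∧ y.2 = x.2)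

def IsRimHook1 (f : ℕ → ℕ) (H : Finset Node1) : Prop :=
  H.Nonempty ∧ ↑H ⊆ Rim1 f ∧
    (∃ l : List Node1, l.Chain' Step1 ∧ ∀ x : Node1, x ∈ l ↔ x ∈ H) ∧
    ∃ g, IsPartition g ∧ Diagram1 g = Diagram1 f \ ↑H

/-- An `e`-core: a partition with no rim `e`-hooks. -/
def IsECore (e : ℕ) (f : ℕ → ℕ) : Prop := ¬ ∃ H : Finset Node1, IsRimHook1 f H ∧ H.card = e

/-- The discrete second difference of `a` at `p`. -/
def bend (a : ℤ → ℤ) (p : ℤ) : ℤ := a (p + 1) + a (p - 1) - 2 * a p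

/-- A nondecreasing function with increments at most one which vanishes far to the right; it
records, with a minus sign, the number of beads at or beyond each position of an abacus. -/
def IsProfile (a : ℤ → ℤ) : Prop :=
  (∀ p, a p ≤ a (p + 1) ∧ a (p + 1) ≤ a p + 1) ∧ ∃ N, ∀ p, N ≤ p → a p = 0

/-- Prefix sums of the signature with contents `j - t * e` for increasing `t`, where at each
content the first component precedes the second. -/
structure IsHeight (e : ℤ) (a b : ℤ → ℤ) (j : ℤ) (P Q : ℤ → ℤ) : Prop where
  mid : ∀ t, Q t = P t + bend a (j - t * e)
  next : ∀ t, P (t + 1) = Q t + bend b (j - t * e)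

/-- Pairs of functions on the integers, used for pairs of profiles. -/
abbrev ProfilePair := (ℤ → ℤ) × (ℤ → ℤ)

/-- Removal of the good node, which lies in the first component. -/
def MoveFst (e : ℤ) (s s' : ProfilePair) : Prop :=
  ∃ j P Q, IsHeight e s.1 s.2 j P Q ∧ (∀ t ≤ 0, P 0 ≤ P t) ∧ (∀ t < 0, P 0 ≤ Q t) ∧
    (∀ t ≥ 0, P 0 < Q t) ∧ (∀ t > 0, P 0 < P t) ∧
    s' = (Function.update s.1 j (s.1 j + 1), s.2)

/-- Removal of the good node, which lies in the second component. -/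
def MoveSnd (e : ℤ) (s s' : ProfilePair) : Prop :=
  ∃ j P Q, IsHeight e s.1 s.2 j P Q ∧ (∀ t ≤ 0, Q 0 ≤ P t) ∧ (∀ t ≤ 0, Q 0 ≤ Q t) ∧
    (∀ t > 0, Q 0 < P t) ∧ (∀ t > 0, Q 0 < Q t) ∧
    s' = (s.1, Function.update s.2 j (s.2 j + 1))

/-- Removal of a good node, with respect to the ordering of nodes by decreasing content. -/
def Move (e : ℤ) (s s' : ProfilePair) : Prop :=
  (IsProfile s.1 ∧ IsProfile s.2) ∧ (IsProfile s'.1 ∧ IsProfile s'.2) ∧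
    (MoveFst e s s' ∨ MoveSnd e s s')

/-- The infimum of `D` over the half-line starting at `p`. -/
noncomputable def futureInf (D : ℤ → ℤ) (p : ℤ) : ℤ := sInf (D '' Set.Ici p)

/-- The crystal reflection moving every unmatched bead from the first abacus to the second. -/
noncomputable def reflect (s : ProfilePair) : ProfilePair :=
  (fun p => s.1 p - futureInf (fun q => s.1 q - s.2 q) p,
    fun p => s.2 p + futureInf (fun q => s.1 q - s.2 q) p)

/-- Exchange of the two components, together with a shift of the old first one by `e`. -/
def rotate (e : ℤ) (s : ProfilePair) : ProfilePair := (s.2, fun p => s.1 (p - e))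

theorem futureInf_eq_min {D : ℤ → ℤ} {N : ℤ} (hD : ∀ p, N ≤ p → D p = 0) (p : ℤ) :
    futureInf D p = min (D p) (futureInf D (p + 1)) := by
  have hbdd : ∀ p, BddBelow (D '' Set.Ici p) := by
    intro p
    have hfin : (D '' Set.Ici p).Finite := by
      refine ((Set.finite_Icc p N).image D |>.union (Set.finite_singleton 0)).subset ?_
      rintro _ ⟨q, hq, rfl⟩
      by_cases h : q ≤ N
      · exact Or.inl ⟨q, ⟨hq, h⟩, rfl⟩
      · exact Or.inr (hD q (by omega))
    exact hfin.bddBelow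
  have hset : D '' Set.Ici p = insert (D p) (D '' Set.Ici (p + 1)) := by
    rw [← Set.image_insert_eq]
    congr 1
    ext q
    simp only [Set.mem_Ici, Set.mem_insert_iff]
    omega
  rw [futureInf, hset, csInf_insert (hbdd _) ⟨_, p + 1, by simp, rfl⟩]
  rfl

theorem futureInf_eq_zero {D : ℤ → ℤ} {N : ℤ} (hD : ∀ p, N ≤ p → D p = 0) {p : ℤ}
    (hp : N ≤ p) : futureInf D p = 0 := by
  have : D '' Set.Ici p = {0} := by
    ext x
    constructor
    · rintro ⟨q, hq, rfl⟩
      exact hD q (le_trans hp hq)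
    · rintro rfl
      exact ⟨p, by simp, hD p hp⟩
  rw [futureInf, this, csInf_singleton]

theorem futureInf_unique {D f : ℤ → ℤ} {N : ℤ} (hD : ∀ p, N ≤ p → D p = 0)
    (hf : ∀ p, f p = min (D p) (f (p + 1))) (hfN : ∀ p, N ≤ p → f p = 0) :
    futureInf D = f := by
  have key : ∀ n : ℕ, ∀ p, N - n ≤ p → futureInf D p = f p := by
    intro n
    induction n with
    | zero =>
      intro p hp
      rw [futureInf_eq_zero hD (by simpa using hp), hfN p (by simpa using hp)]
    | succ n ih =>
      intro p hp
      rw [futureInf_eq_min hD, hf p, ih (p + 1) (by push_cast at hp; omega)]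
  funext p
  exact key (N - p).toNat p (by omega)

theorem IsProfile.exists_common_bound {a b : ℤ → ℤ} (ha : IsProfile a) (hb : IsProfile b) :
    ∃ N, ∀ p, N ≤ p → a p = 0 ∧ b p = 0 := by
  obtain ⟨N, hN⟩ := ha.2
  obtain ⟨M, hM⟩ := hb.2
  exact ⟨max N M, fun p hp => ⟨hN p (by omega), hM p (by omega)⟩⟩

theorem futureInf_sub_eq_min {a b : ℤ → ℤ} (ha : IsProfile a) (hb : IsProfile b) (p : ℤ) :
    futureInf (fun q => a q - b q) p =
      min (a p - b p) (futureInf (fun q => a q - b q) (p + 1)) := by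
  obtain ⟨N, hN⟩ := ha.exists_common_bound hb
  exact futureInf_eq_min (N := N) (fun p hp => by simp [hN p hp]) p

theorem IsProfile.reflect {s : ProfilePair} (ha : IsProfile s.1) (hb : IsProfile s.2) :
    IsProfile (reflect s).1 ∧ IsProfile (reflect s).2 := by
  obtain ⟨N, hN⟩ := ha.exists_common_bound hb
  have hzero : ∀ p, N ≤ p → futureInf (fun q => s.1 q - s.2 q) p = 0 := fun p hp =>
    futureInf_eq_zero (fun q hq => by simp [hN q hq]) hp
  refine ⟨⟨fun p => ?_, N, fun p hp => ?_⟩, ⟨fun p => ?_, N, fun p hp => ?_⟩⟩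
  · have h1 := futureInf_sub_eq_min ha hb p
    have h2 := futureInf_sub_eq_min ha hb (p + 1)
    have h3 := ha.1 p
    have h4 := hb.1 p
    simp only [Wt3.reflect]
    omega
  · simp [Wt3.reflect, hzero p hp, hN p hp]
  · have h1 := futureInf_sub_eq_min ha hb p
    have h2 := futureInf_sub_eq_min ha hb (p + 1)
    have h3 := ha.1 p
    have h4 := hb.1 p
    simp only [Wt3.reflect]
    omega
  · simp [Wt3.reflect, hzero p hp, hN p hp]

theorem bend_reflect_add (s : ProfilePair) (p : ℤ) :
    bend (reflect s).1 p + bend (reflect s).2 p = bend s.1 p + bend s.2 p := by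
  simp only [bend, reflect]
  ring

theorem IsProfile.bend_mem {a : ℤ → ℤ} (ha : IsProfile a) (p : ℤ) :
    -1 ≤ bend a p ∧ bend a p ≤ 1 := by
  have h1 := ha.1 p
  have h2 := ha.1 (p - 1)
  rw [sub_add_cancel] at h2
  simp only [bend]
  omega

theorem bend_of_bend_reflect {s : ProfilePair} (ha : IsProfile s.1) (hb : IsProfile s.2) {p : ℤ}
    (h : bend (reflect s).1 p = -1) (h' : bend (reflect s).2 p = 1) : bend s.1 p = -1 := by
  have h1 := futureInf_sub_eq_min ha hb p
  have h2 := futureInf_sub_eq_min ha hb (p + 1)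
  have h3 := futureInf_sub_eq_min ha hb (p - 1)
  have h4 := ha.1 p
  have h5 := hb.1 p
  have h6 := ha.1 (p - 1)
  have h7 := hb.1 (p - 1)
  rw [sub_add_cancel] at h3 h6 h7
  simp only [bend, reflect] at h h' ⊢
  omega

theorem IsHeight.reflect {e : ℤ} {s : ProfilePair} {j : ℤ} {P Q : ℤ → ℤ}
    (h : IsHeight e s.1 s.2 j P Q) (ha : IsProfile s.1) (hb : IsProfile s.2) :
    ∃ Q', IsHeight e (reflect s).1 (reflect s).2 j P Q' ∧
      ∀ t, min (min (P t) (Q t)) (P (t + 1)) ≤ Q' t := by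
  refine ⟨fun t => P t + bend (Wt3.reflect s).1 (j - t * e), ⟨fun t => rfl, fun t => ?_⟩,
    fun t => ?_⟩
  · have h1 := bend_reflect_add s (j - t * e)
    have h2 := h.mid t
    have h3 := h.next t
    omega
  · have h1 := bend_reflect_add s (j - t * e)
    have h2 := h.mid t
    have h3 := h.next t
    have h4 := bend_of_bend_reflect ha hb (p := j - t * e)
    obtain ⟨hp, hq⟩ := IsProfile.reflect ha hb
    have h5 := hp.bend_mem (j - t * e)
    have h6 := hq.bend_mem (j - t * e)
    simp only
    omega

theorem futureInf_update {D D' : ℤ → ℤ} {N j x : ℤ} (hD : ∀ p, N ≤ p → D p = 0)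
    (hD' : ∀ p, N ≤ p → D' p = 0) (hne : ∀ p, p ≠ j → D' p = D p)
    (hx : x = min (D' j) (futureInf D (j + 1)))
    (hx' : min (D (j - 1)) x = futureInf D (j - 1)) :
    futureInf D' = Function.update (futureInf D) j x := by
  have hrec : ∀ p, Function.update (futureInf D) j x p =
      min (D' p) (Function.update (futureInf D) j x (p + 1)) := by
    intro p
    rcases eq_or_ne p j with rfl | hp
    · rw [Function.update_self, Function.update_of_ne (by omega), hx]
    · rw [Function.update_of_ne hp, hne p hp]
      rcases eq_or_ne p (j - 1) with rfl | hp'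
      · rw [sub_add_cancel, Function.update_self, hx']
      · rw [Function.update_of_ne (by omega)]
        exact futureInf_eq_min hD p
  have hbig : ∀ p, max N (j + 1) ≤ p → Function.update (futureInf D) j x p = 0 := by
    intro p hp
    rw [Function.update_of_ne (by omega)]
    exact futureInf_eq_zero hD (by omega)
  exact futureInf_unique (N := max N (j + 1)) (fun p hp => hD' p (by omega)) hrec hbig

theorem reflect_update {s s' : ProfilePair} (ha : IsProfile s.1) (hb : IsProfile s.2)
    (ha' : IsProfile s'.1) (hb' : IsProfile s'.2) {j x : ℤ}
    (hne : ∀ p, p ≠ j → s'.1 p = s.1 p ∧ s'.2 p = s.2 p)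
    (hx : x = min (s'.1 j - s'.2 j) (futureInf (fun q => s.1 q - s.2 q) (j + 1)))
    (hx' : min (s.1 (j - 1) - s.2 (j - 1)) x = futureInf (fun q => s.1 q - s.2 q) (j - 1)) :
    reflect s' = (Function.update (reflect s).1 j (s'.1 j - x),
      Function.update (reflect s).2 j (s'.2 j + x)) := by
  obtain ⟨N, hN⟩ := ha.exists_common_bound hb
  obtain ⟨N', hN'⟩ := ha'.exists_common_bound hb'
  have h := futureInf_update (D := fun q => s.1 q - s.2 q) (D' := fun q => s'.1 q - s'.2 q)
    (N := max N N') (j := j) (x := x) (fun p hp => by simp [hN p (by omega)])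
    (fun p hp => by simp [hN' p (by omega)]) (fun p hp => by simp [hne p hp]) hx hx'
  refine Prod.ext (funext fun p => ?_) (funext fun p => ?_) <;> rcases eq_or_ne p j with rfl | hp
  · simp [reflect, h]
  · simp [reflect, h, hp, hne p hp]
  · simp [reflect, h]
  · simp [reflect, h, hp, hne p hp]

theorem IsHeight.at_zero {e : ℤ} {a b : ℤ → ℤ} {j : ℤ} {P Q : ℤ → ℤ}
    (h : IsHeight e a b j P Q) : Q 0 = P 0 + bend a j ∧ P 1 = Q 0 + bend b j := by
  have h1 := h.mid 0
  have h2 := h.next 0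
  simpa using And.intro h1 h2

theorem MoveFst.bend_eq {e : ℤ} {s s' : ProfilePair} (h : MoveFst e s s')
    (ha : IsProfile s.1) (hb : IsProfile s.2) :
    ∃ j, s' = (Function.update s.1 j (s.1 j + 1), s.2) ∧ bend s.1 j = 1 ∧ 0 ≤ bend s.2 j := by
  obtain ⟨j, P, Q, hPQ, -, -, h1, h2, h3⟩ := h
  have h4 := h1 0 le_rfl
  have h5 := h2 1 one_pos
  have h6 := hPQ.at_zero
  have h7 := ha.bend_mem j
  have h8 := hb.bend_mem j
  exact ⟨j, h3, by omega, by omega⟩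

theorem MoveSnd.bend_eq {e : ℤ} {s s' : ProfilePair} (h : MoveSnd e s s')
    (ha : IsProfile s.1) (hb : IsProfile s.2) :
    ∃ j, s' = (s.1, Function.update s.2 j (s.2 j + 1)) ∧ bend s.2 j = 1 ∧ bend s.1 j ≤ 0 := by
  obtain ⟨j, P, Q, hPQ, h0, -, h1, -, h3⟩ := h
  have h4 := h0 0 le_rfl
  have h5 := h1 1 one_pos
  have h6 := hPQ.at_zero
  have h7 := ha.bend_mem j
  have h8 := hb.bend_mem j
  exact ⟨j, h3, by omega, by omega⟩

theorem Move.sub_le_iff {e : ℤ} {s s' : ProfilePair} (h : Move e s s') (c : ℤ) :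
    (∀ p, c ≤ s.1 p - s.2 p) ↔ ∀ p, c ≤ s'.1 p - s'.2 p := by
  obtain ⟨⟨ha, hb⟩, -, h | h⟩ := h
  all_goals
    obtain ⟨j, rfl, h1, h2⟩ := h.bend_eq ha hb
    clear h
    have h3 := ha.1 j
    have h4 := hb.1 j
    have h5 := ha.1 (j - 1)
    have h6 := hb.1 (j - 1)
    rw [sub_add_cancel] at h5 h6
    simp only [bend] at h1 h2
    refine ⟨fun h p => ?_, fun h p => ?_⟩ <;> rcases eq_or_ne p j with rfl | hp
    · have h7 := h p
      have h8 := h (p - 1)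
      have h9 := h (p + 1)
      simp only [Function.update_self]
      omega
    · have h7 := h p
      simpa [hp] using h7
    · have h7 := h p
      have h8 := h (p - 1)
      have h9 := h (p + 1)
      simp only [Function.update_self, Function.update_of_ne (show p - 1 ≠ p by omega),
        Function.update_of_ne (show p + 1 ≠ p by omega)] at h7 h8 h9
      omega
    · have h7 := h p
      simpa [hp] using h7

theorem MoveFst.reflect {e : ℤ} {s s' : ProfilePair} (h : MoveFst e s s')
    (ha : IsProfile s.1) (hb : IsProfile s.2) (ha' : IsProfile s'.1) (hb' : IsProfile s'.2) :
    MoveFst e (reflect s) (reflect s') ∨ MoveSnd e (reflect s) (reflect s') := by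
  obtain ⟨j, P, Q, hPQ, hP, hQ, hQ', hP', rfl⟩ := h
  have h1 := hQ' 0 le_rfl
  have h2 := hP' 1 one_pos
  obtain ⟨h3, h4⟩ := hPQ.at_zero
  have h5 := ha.1 j
  have h6 := hb.1 j
  have h7 := ha.1 (j - 1)
  have h8 := hb.1 (j - 1)
  have m1 := futureInf_sub_eq_min ha hb (j - 1)
  have m2 := futureInf_sub_eq_min ha hb j
  have m3 := futureInf_sub_eq_min ha hb (j + 1)
  rw [sub_add_cancel] at h7 h8 m1
  obtain ⟨R, hR, hRm⟩ := hPQ.reflect ha hb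
  obtain ⟨r3, r4⟩ := hR.at_zero
  have hup := reflect_update ha hb ha' hb' (j := j) (fun p hp => by simp [hp]) rfl (by
    simp only [Function.update_self]
    simp only [bend] at h3 h4
    omega)
  simp only [Function.update_self] at hup
  rw [hup]
  simp only [bend] at h3 h4
  have hRneg : ∀ t < 0, P 0 ≤ R t := by
    intro t ht
    have g1 := hP t ht.le
    have g2 := hQ t ht
    have g3 := hP (t + 1) (by omega)
    have g4 := hRm t
    omega
  have hRpos : ∀ t > 0, P 0 < R t := by
    intro t ht
    have g1 := hP' t ht
    have g2 := hQ' t ht.le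
    have g3 := hP' (t + 1) (by omega)
    have g4 := hRm t
    omega
  by_cases hc : futureInf (fun q => s.1 q - s.2 q) (j + 1) ≤ s.1 j - s.2 j
  · left
    have hR0 : P 0 < R 0 := by
      simp only [bend, Wt3.reflect] at r3
      omega
    refine ⟨j, P, R, hR, hP, hRneg, fun t ht => ?_, hP', congrArg₂ Prod.mk ?_ ?_⟩
    · rcases ht.eq_or_lt with rfl | ht
      · exact hR0
      · exact hRpos t ht
    · congr 1
      simp only [Wt3.reflect]
      omega
    · rw [Function.update_eq_self_iff]
      simp only [Wt3.reflect]
      omega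
  · right
    have hR0 : P 0 = R 0 := by
      simp only [bend, Wt3.reflect] at r3
      omega
    refine ⟨j, P, R, hR, hR0 ▸ hP, fun t ht => ?_, hR0 ▸ hP', hR0 ▸ hRpos, congrArg₂ Prod.mk ?_ ?_⟩
    · rcases ht.eq_or_lt with rfl | ht
      · exact le_rfl
      · exact hR0 ▸ hRneg t ht
    · rw [Function.update_eq_self_iff]
      simp only [Wt3.reflect]
      omega
    · congr 1
      simp only [Wt3.reflect]
      omega

theorem MoveSnd.reflect {e : ℤ} {s s' : ProfilePair} (h : MoveSnd e s s')
    (ha : IsProfile s.1) (hb : IsProfile s.2) (ha' : IsProfile s'.1) (hb' : IsProfile s'.2) :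
    MoveFst e (reflect s) (reflect s') ∨ MoveSnd e (reflect s) (reflect s') := by
  obtain ⟨j, P, Q, hPQ, hP, hQ, hP', hQ', rfl⟩ := h
  have h1 := hP 0 le_rfl
  have h2 := hP' 1 one_pos
  obtain ⟨h3, h4⟩ := hPQ.at_zero
  have h5 := ha.1 j
  have h6 := hb.1 j
  have h7 := ha.1 (j - 1)
  have h8 := hb.1 (j - 1)
  have m1 := futureInf_sub_eq_min ha hb (j - 1)
  have m2 := futureInf_sub_eq_min ha hb j
  have m3 := futureInf_sub_eq_min ha hb (j + 1)
  rw [sub_add_cancel] at h7 h8 m1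
  obtain ⟨R, hR, hRm⟩ := hPQ.reflect ha hb
  obtain ⟨r3, r4⟩ := hR.at_zero
  have hup := reflect_update ha hb ha' hb' (j := j) (fun p hp => by simp [hp]) rfl (by
    simp only [Function.update_self]
    simp only [bend] at h3 h4
    omega)
  simp only [Function.update_self] at hup
  rw [hup]
  simp only [bend] at h3 h4
  have hRneg : ∀ t < 0, Q 0 ≤ R t := by
    intro t ht
    have g1 := hP t ht.le
    have g2 := hQ t ht.le
    have g3 := hP (t + 1) (by omega)
    have g4 := hRm t
    omega
  have hRpos : ∀ t > 0, Q 0 < R t := by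
    intro t ht
    have g1 := hP' t ht
    have g2 := hQ' t ht
    have g3 := hP' (t + 1) (by omega)
    have g4 := hRm t
    omega
  by_cases hc : futureInf (fun q => s.1 q - s.2 q) (j + 1) < s.1 j - s.2 j
  · right
    have hR0 : Q 0 = R 0 := by
      simp only [bend, Wt3.reflect] at r3
      omega
    refine ⟨j, P, R, hR, hR0 ▸ hP, fun t ht => ?_, hR0 ▸ hP', hR0 ▸ hRpos, congrArg₂ Prod.mk ?_ ?_⟩
    · rcases ht.eq_or_lt with rfl | ht
      · exact le_rfl
      · exact hR0 ▸ hRneg t ht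
    · rw [Function.update_eq_self_iff]
      simp only [Wt3.reflect]
      omega
    · congr 1
      simp only [Wt3.reflect]
      omega
  · left
    have hR0 : P 0 < R 0 := by
      simp only [bend, Wt3.reflect] at r3
      omega
    have hPQ0 : Q 0 = P 0 := by omega
    rw [hPQ0] at hP hP' hRneg hRpos
    refine ⟨j, P, R, hR, hP, hRneg, fun t ht => ?_, hP', congrArg₂ Prod.mk ?_ ?_⟩
    · rcases ht.eq_or_lt with rfl | ht
      · exact hR0
      · exact hRpos t ht
    · congr 1
      simp only [Wt3.reflect]
      omega
    · rw [Function.update_eq_self_iff]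
      simp only [Wt3.reflect]
      omega

theorem Move.reflect {e : ℤ} {s s' : ProfilePair} (h : Move e s s') :
    Move e (reflect s) (reflect s') := by
  obtain ⟨⟨ha, hb⟩, ⟨ha', hb'⟩, h⟩ := h
  exact ⟨IsProfile.reflect ha hb, IsProfile.reflect ha' hb',
    h.elim (fun h => h.reflect ha hb ha' hb') fun h => h.reflect ha hb ha' hb'⟩

theorem IsProfile.comp_sub {a : ℤ → ℤ} (ha : IsProfile a) (d : ℤ) :
    IsProfile fun p => a (p - d) := by
  obtain ⟨h, N, hN⟩ := ha
  refine ⟨fun p => ?_, N + d, fun p hp => hN _ (by omega)⟩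
  have h1 := h (p - d)
  rwa [show p - d + 1 = p + 1 - d by ring] at h1

theorem bend_comp_sub (a : ℤ → ℤ) (d p : ℤ) : bend (fun q => a (q - d)) p = bend a (p - d) := by
  simp only [bend]
  ring_nf

theorem update_comp_sub (a : ℤ → ℤ) (d j x : ℤ) :
    (fun p => Function.update a j x (p - d)) =
      Function.update (fun p => a (p - d)) (j + d) x := by
  funext p
  rcases eq_or_ne p (j + d) with rfl | hp
  · simp
  · rw [Function.update_of_ne hp, Function.update_of_ne (by omega)]

theorem Move.rotate {e : ℤ} {s s' : ProfilePair} (h : Move e s s') :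
    Move e (rotate e s) (rotate e s') := by
  obtain ⟨⟨ha, hb⟩, ⟨ha', hb'⟩, h⟩ := h
  refine ⟨⟨hb, ha.comp_sub e⟩, ⟨hb', ha'.comp_sub e⟩, ?_⟩
  rcases h with ⟨j, P, Q, hPQ, hP, hQ, hQ', hP', rfl⟩ | ⟨j, P, Q, hPQ, hP, hQ, hP', hQ', rfl⟩
  · right
    refine ⟨j + e, fun t => Q (t - 1), P, ⟨fun t => ?_, fun t => ?_⟩, fun t ht => hQ _ (by omega),
      fun t ht => hP t ht, fun t ht => hQ' _ (by omega), fun t ht => hP' t ht, ?_⟩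
    · have h1 := hPQ.next (t - 1)
      rw [show t - 1 + 1 = t by ring, show j - (t - 1) * e = j + e - t * e by ring] at h1
      exact h1
    · have h1 := hPQ.mid t
      simp only [Wt3.rotate, bend_comp_sub]
      rw [show t + 1 - 1 = t by ring, show j + e - t * e - e = j - t * e by ring]
      exact h1
    · simp [Wt3.rotate, update_comp_sub]
  · left
    refine ⟨j, Q, fun t => P (t + 1), ⟨hPQ.next, fun t => ?_⟩, fun t ht => hQ t ht,
      fun t ht => hP _ (by omega), fun t ht => hP' _ (by omega), fun t ht => hQ' t ht, ?_⟩
    · have h1 := hPQ.mid (t + 1)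
      simp only [Wt3.rotate, bend_comp_sub]
      rw [show j - t * e - e = j - (t + 1) * e by ring]
      exact h1
    · simp [Wt3.rotate]

theorem eqvGen_map {α β : Type*} {r : α → α → Prop} {q : β → β → Prop} (f : α → β)
    (hf : ∀ x y, r x y → q (f x) (f y)) {x y : α} (h : Relation.EqvGen r x y) :
    Relation.EqvGen q (f x) (f y) := by
  induction h with
  | rel x y h => exact .rel _ _ (hf x y h)
  | refl x => exact .refl _
  | symm x y _ ih => exact .symm _ _ ih
  | trans x y z _ _ ih ih' => exact .trans _ _ _ ih ih'

theorem eqvGen_move_sub_le_iff {e : ℤ} {s s' : ProfilePair} (h : Relation.EqvGen (Move e) s s')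
    (c : ℤ) : (∀ p, c ≤ s.1 p - s.2 p) ↔ ∀ p, c ≤ s'.1 p - s'.2 p := by
  induction h with
  | rel x y h => exact h.sub_le_iff c
  | refl x => rfl
  | symm x y _ ih => exact ih.symm
  | trans x y z _ _ ih ih' => exact ih.trans ih'

/-- The profile of the empty partition of charge `t`. -/
def vacuum (t p : ℤ) : ℤ := min 0 (p - t)

theorem rotate_reflect_vacuum (e : ℤ) {a : ℤ → ℤ} (ha : IsProfile a) {t : ℤ}
    (hat : ∀ p < t, a (p + 1) = a p + 1) :
    rotate e (reflect (a, vacuum t)) = (a, vacuum (t + e)) := by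
  obtain ⟨N, hN⟩ := ha.2
  have h : futureInf (fun q => a q - vacuum t q) = fun q => a q - vacuum t q := by
    refine futureInf_unique (N := max N t) (fun p hp => ?_) (fun p => ?_) fun p hp => ?_
    · simp only [vacuum, hN p (by omega)]
      omega
    · have h1 := ha.1 p
      have h2 := hat p
      simp only [vacuum]
      omega
    · simp only [vacuum, hN p (by omega)]
      omega
  refine Prod.ext (funext fun p => ?_) (funext fun p => ?_)
  · simp [rotate, reflect, h]
  · simp only [rotate, reflect, h]
    simp only [vacuum]
    omega

theorem isProfile_vacuum (t : ℤ) : IsProfile (vacuum t) :=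
  ⟨fun p => by simp only [vacuum]; omega, t, fun p hp => by simp only [vacuum]; omega⟩

/-- Equivalence with the empty configuration survives bringing the charges together, and finally
confines `a` to a window of width `e`. -/
theorem exists_window {e : ℤ} (he : 0 < e) {a : ℤ → ℤ} (ha : IsProfile a) {s : ℤ}
    (has : ∀ p, a p ≤ vacuum s p) (n : ℕ) : ∀ t, t ≤ s → s - t < n →
    Relation.EqvGen (Move e) (a, vacuum t) (vacuum s, vacuum t) →
    ∃ t₀, e ∣ t₀ - t ∧ t₀ ≤ s ∧ s < t₀ + e ∧ (∀ p ≤ t₀, a p = p - s) ∧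
      ∀ p, t₀ + e ≤ p → a p = 0 := by
  induction n with
  | zero => intro t h1 h2; omega
  | succ n ih =>
    intro t hts hn h
    have hfull : ∀ p ≤ t, a p = p - s := by
      intro p hp
      have h1 := (eqvGen_move_sub_le_iff h (t - s)).2 (fun q => by simp only [vacuum]; omega) p
      have h2 := has p
      simp only [vacuum] at h1 h2
      omega
    have h' : Relation.EqvGen (Move e) (a, vacuum (t + e)) (vacuum s, vacuum (t + e)) := by
      have h1 : Relation.EqvGen (Move e) (rotate e (reflect (a, vacuum t)))
          (rotate e (reflect (vacuum s, vacuum t))) :=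
        eqvGen_map (fun s => rotate e (reflect s)) (fun _ _ h => h.reflect.rotate) h
      rwa [rotate_reflect_vacuum e ha, rotate_reflect_vacuum e (isProfile_vacuum s)] at h1
      · intro p hp
        simp only [vacuum]
        omega
      · intro p hp
        rw [hfull p (by omega), hfull (p + 1) (by omega)]
        ring
    by_cases hc : t + e ≤ s
    · obtain ⟨t₀, h1, h2⟩ := ih (t + e) hc (by push_cast at hn; omega) h'
      refine ⟨t₀, ?_, h2⟩
      have := dvd_add h1 (dvd_refl e)
      rwa [show t₀ - (t + e) + e = t₀ - t by ring] at this
    · refine ⟨t, by simp, hts, by omega, hfull, fun p hp => ?_⟩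
      have h1 := (eqvGen_move_sub_le_iff h' 0).2 (fun q => by simp only [vacuum]; omega) p
      have h2 := has p
      simp only [vacuum] at h1 h2
      omega

/-- The profile of a partition `f` of charge `s`. -/
noncomputable def profile (f : ℕ → ℕ) (s p : ℤ) : ℤ := -(Set.ncard {r : ℕ | p - s + r < f r} : ℤ)

theorem IsPartition.antitone {f : ℕ → ℕ} (hf : IsPartition f) : Antitone f :=
  antitone_nat_of_succ_le hf.1

theorem profile_eq {f : ℕ → ℕ} (hf : IsPartition f) {s p : ℤ} {n : ℕ}
    (h : (f n : ℤ) ≤ p - s + n) (h' : ∀ r < n, p - s + r < f r) : profile f s p = -n := by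
  have hset : {r : ℕ | p - s + r < f r} = (Finset.range n : Set ℕ) := by
    ext r
    simp only [Set.mem_ofPred_eq, Finset.coe_range, Set.mem_Iio]
    refine ⟨fun hr => ?_, h' r⟩
    by_contra! hc
    have := hf.antitone hc
    omega
  rw [profile, hset, Set.ncard_coe_finset, Finset.card_range]

theorem exists_profile_eq {f : ℕ → ℕ} (hf : IsPartition f) (s p : ℤ) :
    ∃ n : ℕ, profile f s p = -n ∧ (f n : ℤ) ≤ p - s + n ∧ ∀ r < n, p - s + r < f r := by
  classical
  have hex : ∃ n : ℕ, (f n : ℤ) ≤ p - s + n := by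
    obtain ⟨N, hN⟩ := hf.2
    refine ⟨max N (s - p).toNat, ?_⟩
    rw [hN _ (le_max_left _ _)]
    omega
  have h2 : ∀ r < Nat.find hex, p - s + r < f r := fun r hr => by
    have := Nat.find_min hex hr
    omega
  exact ⟨Nat.find hex, profile_eq hf (Nat.find_spec hex) h2, Nat.find_spec hex, h2⟩

theorem profile_le_vacuum {f : ℕ → ℕ} (hf : IsPartition f) (s p : ℤ) :
    profile f s p ≤ vacuum s p := by
  obtain ⟨n, h1, h2, -⟩ := exists_profile_eq hf s p
  simp only [vacuum]
  omega

theorem isPartition_zero : IsPartition fun _ => 0 := ⟨fun _ => le_rfl, 0, fun _ _ => rfl⟩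

theorem profile_zero (s : ℤ) : profile (fun _ => 0) s = vacuum s := by
  funext p
  refine le_antisymm (profile_le_vacuum isPartition_zero s p) ?_
  obtain ⟨n, h1, -, h3⟩ := exists_profile_eq isPartition_zero s p
  have h4 := h3 (n - 1)
  simp only [vacuum]
  omega

theorem isProfile_profile {f : ℕ → ℕ} (hf : IsPartition f) (s : ℤ) : IsProfile (profile f s) := by
  refine ⟨fun p => ?_, s + f 0, fun p hp => ?_⟩
  · obtain ⟨n, h1, h2, h3⟩ := exists_profile_eq hf s p
    obtain ⟨m, k1, k2, k3⟩ := exists_profile_eq hf s (p + 1)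
    have g1 := k3 n
    have g2 := h3 (m + 1)
    have g3 := hf.1 m
    omega
  · simpa using profile_eq hf (s := s) (p := p) (n := 0) (by push_cast; omega) (by simp)

theorem bend_profile_of_removable {f : ℕ → ℕ} (hf : IsPartition f) (s : ℤ) {r c : ℕ}
    (h : f r = c + 1) (h' : f (r + 1) < f r) : bend (profile f s) (c - r + s) = 1 := by
  have hle : ∀ k ≤ r, c + 1 ≤ f k := fun k hk => h ▸ hf.antitone hk
  have h1 := profile_eq hf (s := s) (p := c - r + s) (n := r + 1) (by push_cast; omega)
    (fun k hk => by have := hle k (by omega); omega)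
  have h2 := profile_eq hf (s := s) (p := c - r + s + 1) (n := r) (by omega)
    (fun k hk => by have := hle k (by omega); omega)
  have h3 := profile_eq hf (s := s) (p := c - r + s - 1) (n := r + 1) (by push_cast; omega)
    (fun k hk => by have := hle k (by omega); omega)
  rw [bend, h1, h2, h3]
  push_cast
  ring

theorem bend_profile_of_addable {f : ℕ → ℕ} (hf : IsPartition f) (s : ℤ) {r c : ℕ}
    (h : f r = c) (h' : r = 0 ∨ f r < f (r - 1)) : bend (profile f s) (c - r + s) = -1 := by
  have hle : ∀ k < r, c + 1 ≤ f k := fun k hk => by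
    have := hf.antitone (show k ≤ r - 1 by omega)
    omega
  have hs := hf.1 r
  have h1 := profile_eq hf (s := s) (p := c - r + s) (n := r) (by omega)
    (fun k hk => by have := hle k hk; omega)
  have h2 := profile_eq hf (s := s) (p := c - r + s + 1) (n := r) (by omega)
    (fun k hk => by have := hle k hk; omega)
  have h3 := profile_eq hf (s := s) (p := c - r + s - 1) (n := r + 1) (by push_cast; omega)
    (fun k hk => by
      rcases eq_or_ne k r with rfl | hk'
      · omega
      · have := hle k (by omega)
        omega)
  rw [bend, h1, h2, h3]
  push_cast
  ring

theorem exists_removable_of_bend_profile {f : ℕ → ℕ} (hf : IsPartition f) {s p : ℤ}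
    (h : bend (profile f s) p = 1) :
    ∃ r c : ℕ, p = c - r + s ∧ f r = c + 1 ∧ f (r + 1) < f r := by
  have h4 := (isProfile_profile hf s).1 p
  have h5 := (isProfile_profile hf s).1 (p - 1)
  rw [sub_add_cancel] at h5
  obtain ⟨n, h1, h2, h3⟩ := exists_profile_eq hf s p
  obtain ⟨m, k1, k2, k3⟩ := exists_profile_eq hf s (p + 1)
  obtain ⟨l, g1, g2, g3⟩ := exists_profile_eq hf s (p - 1)
  simp only [bend] at h
  obtain rfl : n = m + 1 := by omega
  obtain rfl : l = m + 1 := by omega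
  have h6 := h3 m (by omega)
  push_cast at g2
  exact ⟨m, f m - 1, by omega, by omega, by omega⟩

theorem exists_addable_of_bend_profile {f : ℕ → ℕ} (hf : IsPartition f) {s p : ℤ}
    (h : bend (profile f s) p = -1) :
    ∃ r c : ℕ, p = c - r + s ∧ f r = c ∧ (r = 0 ∨ f r < f (r - 1)) := by
  have h4 := (isProfile_profile hf s).1 p
  have h5 := (isProfile_profile hf s).1 (p - 1)
  rw [sub_add_cancel] at h5
  obtain ⟨n, h1, h2, h3⟩ := exists_profile_eq hf s p
  obtain ⟨m, k1, k2, k3⟩ := exists_profile_eq hf s (p + 1)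
  obtain ⟨l, g1, g2, g3⟩ := exists_profile_eq hf s (p - 1)
  simp only [bend] at h
  obtain rfl : n = m := by omega
  obtain rfl : l = n + 1 := by omega
  have h6 := g3 n (by omega)
  have h7 := k3 (n - 1)
  exact ⟨n, f n, by omega, rfl, by omega⟩

theorem profile_remove {f g : ℕ → ℕ} (hf : IsPartition f) (hg : IsPartition g) (s : ℤ) {r c : ℕ}
    (hfr : f r = c + 1) (hgr : g r = c) (hne : ∀ k, k ≠ r → g k = f k) :
    profile g s = Function.update (profile f s) (c - r + s) (profile f s (c - r + s) + 1) := by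
  funext p
  rcases eq_or_ne p (c - r + s) with rfl | hp
  · have hle : ∀ k ≤ r, c + 1 ≤ f k := fun k hk => hfr ▸ hf.antitone hk
    have h0 := hg.1 r
    have h1 := hne (r + 1) (by omega)
    rw [Function.update_self, profile_eq hf (n := r + 1), profile_eq hg (n := r)]
    · push_cast
      ring
    · omega
    · intro k hk
      have h2 := hle k hk.le
      rw [hne k hk.ne]
      omega
    · push_cast
      omega
    · intro k hk
      have h2 := hle k (by omega)
      omega
  · rw [Function.update_of_ne hp, profile, profile]
    congr 3
    ext k
    rcases eq_or_ne k r with rfl | hk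
    · simp only [Set.mem_ofPred_eq]
      omega
    · simp [hne k hk]

theorem lt_iff_of_diagram_eq {lam mu : Fin 2 → ℕ → ℕ} {x : Node}
    (h : Diagram mu = Diagram lam \ {x}) (r c : ℕ) (a : Fin 2) :
    c < mu a r ↔ c < lam a r ∧ (r, c, a) ≠ x := by
  have := Set.ext_iff.1 h (r, c, a)
  simpa [Diagram] using this

theorem apply_of_diagram_eq {lam mu : Fin 2 → ℕ → ℕ} {r c : ℕ} {a : Fin 2}
    (h : Diagram mu = Diagram lam \ {(r, c, a)}) (hx : c < lam a r) :
    lam a r = c + 1 ∧ mu a r = c ∧ ∀ k b, (k, b) ≠ (r, a) → mu b k = lam b k := by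
  have h1 := lt_iff_of_diagram_eq h
  have h2 := h1 r c a
  have h3 := h1 r (c + 1) a
  have h4 := h1 r (c - 1) a
  simp only [ne_eq, Prod.mk.injEq, true_and, and_true, not_true_eq_false, and_false,
    iff_false] at h2 h3 h4
  refine ⟨by omega, by omega, fun k b hkb => ?_⟩
  refine eq_of_forall_lt_iff fun d => (h1 k d b).trans (and_iff_left ?_)
  rintro heq
  simp only [Prod.mk.injEq] at heq
  exact hkb (by simp [heq])

theorem isRemovable_iff {lam : Fin 2 → ℕ → ℕ} (hlam : IsBipartition lam) {r c : ℕ} {a : Fin 2} :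
    IsRemovable lam (r, c, a) ↔ lam a r = c + 1 ∧ lam a (r + 1) < lam a r := by
  constructor
  · rintro ⟨hx, mu, hmu, h⟩
    obtain ⟨h1, h2, h3⟩ := apply_of_diagram_eq h hx
    have h4 := (hmu a).1 r
    rw [h3 (r + 1) a (by simp)] at h4
    exact ⟨h1, by omega⟩
  · rintro ⟨h1, h2⟩
    refine ⟨by simp [Diagram, h1], Function.update lam a (Function.update (lam a) r c), ?_, ?_⟩
    · intro b
      rcases eq_or_ne b a with rfl | hb
      · rw [Function.update_self]
        obtain ⟨h3, N, hN⟩ := hlam b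
        refine ⟨fun k => ?_, max N (r + 1), fun k hk => ?_⟩
        · have h4 := h3 k
          rcases eq_or_ne k r with rfl | hk
          · simp only [Function.update_self, Function.update_of_ne (show k + 1 ≠ k by omega)]
            omega
          · rcases eq_or_ne (k + 1) r with rfl | hk'
            · simp only [Function.update_self, Function.update_of_ne hk]
              omega
            · simpa [hk, hk'] using h4
        · rw [Function.update_of_ne (by omega)]
          exact hN k (by omega)
      · simpa [hb] using hlam b
    · ext ⟨k, d, b⟩
      simp only [Diagram, Set.mem_ofPred_eq, Set.mem_sdiff, Set.mem_singleton_iff, Prod.mk.injEq]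
      rcases eq_or_ne b a with rfl | hb
      · rcases eq_or_ne k r with rfl | hk
        · simp only [Function.update_self, h1, and_true, true_and]
          omega
        · simp [hk]
      · simp [hb]

theorem isAddable_iff {lam : Fin 2 → ℕ → ℕ} (hlam : IsBipartition lam) {r c : ℕ} {a : Fin 2} :
    IsAddable lam (r, c, a) ↔ lam a r = c ∧ (r = 0 ∨ lam a r < lam a (r - 1)) := by
  constructor
  · rintro ⟨hx, mu, hmu, h⟩
    have hlt : ∀ k d b, d < mu b k ↔ d < lam b k ∨ (k, d, b) = (r, c, a) := by
      intro k d b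
      have := Set.ext_iff.1 h (k, d, b)
      simpa [Diagram, or_comm] using this
    have hx' : ¬ c < lam a r := hx
    have h1 := hlt r c a
    have h2 := hlt r (c - 1) a
    have h3 := hlt (r - 1) c a
    have h4 := (hmu a).antitone (show r - 1 ≤ r by omega)
    simp only [Prod.mk.injEq, true_and, and_true, or_true, iff_true] at h1 h2 h3
    omega
  · rintro ⟨h1, h2⟩
    refine ⟨by simp [Diagram, h1], Function.update lam a (Function.update (lam a) r (c + 1)),
      ?_, ?_⟩
    · intro b
      rcases eq_or_ne b a with rfl | hb
      · rw [Function.update_self]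
        obtain ⟨h3, N, hN⟩ := hlam b
        refine ⟨fun k => ?_, max N (r + 1), fun k hk => ?_⟩
        · have h4 := h3 k
          rcases eq_or_ne k r with rfl | hk
          · simp only [Function.update_self, Function.update_of_ne (show k + 1 ≠ k by omega)]
            omega
          · rcases eq_or_ne (k + 1) r with rfl | hk'
            · simp only [Function.update_self, Function.update_of_ne hk]
              simp only [add_tsub_cancel_right] at h2
              omega
            · simpa [hk, hk'] using h4
        · rw [Function.update_of_ne (by omega)]
          exact hN k (by omega)
      · simpa [hb] using hlam b
    · ext ⟨k, d, b⟩
      simp only [Diagram, Set.mem_ofPred_eq, Set.mem_union, Set.mem_singleton_iff, Prod.mk.injEq]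
      rcases eq_or_ne b a with rfl | hb
      · rcases eq_or_ne k r with rfl | hk
        · simp only [Function.update_self, h1, and_true, true_and]
          omega
        · simp [hk]
      · simp [hb]

theorem exists_int_antiderivative (U : ℤ → ℤ) : ∃ P : ℤ → ℤ, ∀ n, P (n + 1) = P n + U n := by
  refine ⟨fun n => ∑ k ∈ Finset.Ico 0 n, U k - ∑ k ∈ Finset.Ico n 0, U k, fun n => ?_⟩
  rcases le_or_gt 0 n with hn | hn
  · have h1 : Finset.Ico 0 (n + 1) = insert n (Finset.Ico 0 n) := by
      ext k
      simp only [Finset.mem_Ico, Finset.mem_insert]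
      omega
    simp only [h1, Finset.Ico_eq_empty_of_le hn,
      Finset.Ico_eq_empty_of_le (show 0 ≤ n + 1 by omega)]
    rw [Finset.sum_insert (by simp)]
    simp
    ring
  · have h1 : Finset.Ico n 0 = insert n (Finset.Ico (n + 1) 0) := by
      ext k
      simp only [Finset.mem_Ico, Finset.mem_insert]
      omega
    simp only [h1, Finset.Ico_eq_empty_of_le hn.le,
      Finset.Ico_eq_empty_of_le (show n + 1 ≤ 0 by omega)]
    rw [Finset.sum_insert (by simp)]
    simp

theorem ncard_sub_ncard_eq {U P : ℤ → ℤ} (hU : ∀ n, U n = -1 ∨ U n = 0 ∨ U n = 1)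
    (hP : ∀ n, P (n + 1) = P n + U n) {x y : ℤ} (hxy : x + 1 ≤ y) :
    (Set.ncard {z | U z = 1 ∧ x < z ∧ z < y} : ℤ) - Set.ncard {z | U z = -1 ∧ x < z ∧ z < y} =
      P y - P (x + 1) := by
  have hfin : ∀ c y : ℤ, {z | U z = c ∧ x < z ∧ z < y}.Finite := fun c y =>
    (Set.finite_Ioo x y).subset fun z hz => hz.2
  induction y, hxy using Int.leInduction with
  | base =>
    have h : ∀ c, {z | U z = c ∧ x < z ∧ z < x + 1} = ∅ := by
      intro c
      ext z
      simp only [Set.mem_ofPred_eq, Set.mem_empty_iff_false, iff_false]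
      omega
    rw [h, h]
    simp
  | succ y hy ih =>
    have hins : ∀ c, U y = c → {z | U z = c ∧ x < z ∧ z < y + 1} =
        insert y {z | U z = c ∧ x < z ∧ z < y} := by
      rintro c rfl
      ext z
      simp only [Set.mem_ofPred_eq, Set.mem_insert_iff]
      refine ⟨fun h => ?_, ?_⟩
      · by_cases hz : z = y
        · exact Or.inl hz
        · exact Or.inr ⟨h.1, h.2.1, by omega⟩
      · rintro (rfl | h)
        · exact ⟨rfl, by omega, by omega⟩
        · exact ⟨h.1, h.2.1, by omega⟩
    have hsame : ∀ c, U y ≠ c → {z | U z = c ∧ x < z ∧ z < y + 1} =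
        {z | U z = c ∧ x < z ∧ z < y} := by
      intro c hc
      ext z
      simp only [Set.mem_ofPred_eq]
      refine ⟨fun h => ⟨h.1, h.2.1, ?_⟩, fun h => ⟨h.1, h.2.1, by omega⟩⟩
      have : z ≠ y := by rintro rfl; exact hc h.1
      omega
    have hcard : ∀ c, U y = c → Set.ncard {z | U z = c ∧ x < z ∧ z < y + 1} =
        Set.ncard {z | U z = c ∧ x < z ∧ z < y} + 1 := by
      intro c hc
      rw [hins c hc, Set.ncard_insert_of_notMem (by simp) (hfin c y)]
    rw [hP y]
    rcases hU y with h | h | h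
    · rw [hcard (-1) h, hsame 1 (by omega)]
      push_cast
      omega
    · rw [hsame (-1) (by omega), hsame 1 (by omega)]
      omega
    · rw [hcard 1 h, hsame (-1) (by omega)]
      push_cast
      omega

/-- A sign of a sequence `U` which survives the cancellation of adjacent pairs. -/
def IsNormalSign (U : ℤ → ℤ) (x : ℤ) : Prop :=
  U x = 1 ∧ ∀ y, U y = -1 → x < y →
    Set.ncard {z | U z = -1 ∧ x < z ∧ z < y} < Set.ncard {z | U z = 1 ∧ x < z ∧ z < y}

theorem isNormalSign_iff {U P : ℤ → ℤ} (hU : ∀ n, U n = -1 ∨ U n = 0 ∨ U n = 1)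
    (hP : ∀ n, P (n + 1) = P n + U n) {x : ℤ} :
    IsNormalSign U x ↔ ∀ n, x < n → P x < P n := by
  have hx := hP x
  constructor
  · rintro ⟨h1, h2⟩ n hn
    induction n, Int.add_one_le_iff.2 hn using Int.leInduction with
    | base => omega
    | succ n hxn ih =>
      have h3 := hP n
      have h4 := h2 n
      have h5 := ncard_sub_ncard_eq hU hP hxn
      have h6 := ih (by omega)
      rcases hU n with h | h | h
      · have h7 := h4 h (by omega)
        omega
      · omega
      · omega
  · intro h
    have h1 := h (x + 1) (by omega)
    refine ⟨by have := hU x; omega, fun y hy hxy => ?_⟩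
    have h2 := h (y + 1) (by omega)
    have h3 := hP y
    have h5 := ncard_sub_ncard_eq hU hP (x := x) hxy
    have := hU x
    omega

theorem exists_partial_sum_of_good {U : ℤ → ℤ} (hU : ∀ n, U n = -1 ∨ U n = 0 ∨ U n = 1) {x : ℤ}
    (hx : IsNormalSign U x) (hmin : ∀ y, IsNormalSign U y → x ≤ y) :
    ∃ P : ℤ → ℤ, (∀ n, P (n + 1) = P n + U n) ∧ (∀ n ≤ x, P x ≤ P n) ∧
      ∀ n, x < n → P x < P n := by
  obtain ⟨P, hP⟩ := exists_int_antiderivative U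
  have hafter := (isNormalSign_iff hU hP).1 hx
  refine ⟨P, hP, ?_, hafter⟩
  by_contra! hc
  obtain ⟨w, ⟨hwx, hw⟩, hmax⟩ := Int.exists_greatest_of_bdd
    (P := fun n => n ≤ x ∧ P n < P x) ⟨x, fun z hz => hz.1⟩ hc
  have hwn : IsNormalSign U w := by
    refine (isNormalSign_iff hU hP).2 fun n hn => ?_
    rcases lt_or_ge x n with h | h
    · exact hw.trans (hafter n h)
    · by_contra! hcon
      have := hmax n ⟨h, by omega⟩
      omega
  have h1 := hmin w hwn
  obtain rfl : w = x := by omega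
  omega

/-- The content of a node with respect to the charges `S`, an integer lift of its residue. -/
def content (S : Fin 2 → ℤ) (z : Node) : ℤ := z.2.1 - z.1 + S z.2.2

/-- The nodes which are either removable or addable. -/
def IsCorner (lam : Fin 2 → ℕ → ℕ) (z : Node) : Prop := IsRemovable lam z ∨ IsAddable lam z

/-- The charges are so far apart that reading the removable and addable nodes from top to bottom
amounts to reading them by decreasing contents. -/
def IsSeparated (S : Fin 2 → ℤ) (lam : Fin 2 → ℕ → ℕ) : Prop :=
  ∃ n : ℕ, (∀ r, n ≤ r → lam 0 r = 0) ∧ n + lam 1 0 + S 1 ≤ S 0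

/-- The component encoded by the parity of an integer. -/
def parity (n : ℤ) : Fin 2 := if n % 2 = 0 then 0 else 1

/-- The sequence of signs of the nodes whose contents are congruent to `j` modulo `e`. -/
noncomputable def signature (e : ℤ) (S : Fin 2 → ℤ) (lam : Fin 2 → ℕ → ℕ) (j n : ℤ) : ℤ :=
  bend (profile (lam (parity n)) (S (parity n))) (j - n / 2 * e)

/-- The index in `signature` of the sign of a node. -/
def position (e : ℤ) (S : Fin 2 → ℤ) (j : ℤ) (z : Node) : ℤ :=
  2 * ((j - content S z) / e) + (z.2.2 : ℕ)

theorem parity_two_mul_add (t : ℤ) (a : Fin 2) : parity (2 * t + (a : ℕ)) = a := by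
  fin_cases a <;> simp [parity]

theorem two_mul_add_ediv_two (t : ℤ) (a : Fin 2) : (2 * t + (a : ℕ)) / 2 = t := by
  have := a.2
  omega

theorem res_eq_iff_dvd {e : ℕ} {κ : Fin 2 → ZMod e} {S : Fin 2 → ℤ} (hS : ∀ a, (S a : ZMod e) = κ a)
    {i : ZMod e} {j : ℤ} (hj : (j : ZMod e) = i) (z : Node) :
    res e κ z = i ↔ (e : ℤ) ∣ j - content S z := by
  rw [← ZMod.intCast_eq_intCast_iff_dvd_sub, hj, content]
  push_cast
  rw [hS, res]

theorem signature_mem {lam : Fin 2 → ℕ → ℕ} (hlam : IsBipartition lam) (e : ℤ) (S : Fin 2 → ℤ)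
    (j n : ℤ) : signature e S lam j n = -1 ∨ signature e S lam j n = 0 ∨
      signature e S lam j n = 1 := by
  have := (isProfile_profile (hlam (parity n)) (S (parity n))).bend_mem (j - n / 2 * e)
  simp only [signature]
  omega

theorem signature_position {e : ℤ} {S : Fin 2 → ℤ} (lam : Fin 2 → ℕ → ℕ) {j : ℤ} {z : Node}
    (hz : e ∣ j - content S z) :
    signature e S lam j (position e S j z) =
      bend (profile (lam z.2.2) (S z.2.2)) (content S z) := by
  rw [signature, position, parity_two_mul_add, two_mul_add_ediv_two, Int.ediv_mul_cancel hz,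
    sub_sub_cancel]

theorem IsRemovable.bend_eq {lam : Fin 2 → ℕ → ℕ} (hlam : IsBipartition lam) {z : Node}
    (hz : IsRemovable lam z) (S : Fin 2 → ℤ) :
    bend (profile (lam z.2.2) (S z.2.2)) (content S z) = 1 := by
  obtain ⟨h1, h2⟩ := (isRemovable_iff hlam).1 hz
  exact bend_profile_of_removable (hlam _) _ h1 h2

theorem IsAddable.bend_eq {lam : Fin 2 → ℕ → ℕ} (hlam : IsBipartition lam) {z : Node}
    (hz : IsAddable lam z) (S : Fin 2 → ℤ) :
    bend (profile (lam z.2.2) (S z.2.2)) (content S z) = -1 := by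
  obtain ⟨h1, h2⟩ := (isAddable_iff hlam).1 hz
  exact bend_profile_of_addable (hlam _) _ h1 h2

theorem position_eq {e : ℤ} (he : e ≠ 0) {S : Fin 2 → ℤ} {j n : ℤ} {r c : ℕ}
    (h : j - n / 2 * e = c - r + S (parity n)) :
    e ∣ j - content S (r, c, parity n) ∧ position e S j (r, c, parity n) = n := by
  have h1 : j - content S (r, c, parity n) = n / 2 * e := by
    simp only [content]
    omega
  refine ⟨⟨n / 2, by rw [h1, mul_comm]⟩, ?_⟩
  rw [position, h1, Int.mul_ediv_cancel _ he, parity]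
  split_ifs with h2
  · simp
    omega
  · simp
    omega

theorem exists_removable_of_signature {e : ℤ} (he : e ≠ 0) {S : Fin 2 → ℤ} {lam : Fin 2 → ℕ → ℕ}
    (hlam : IsBipartition lam) {j n : ℤ} (h : signature e S lam j n = 1) :
    ∃ z, IsRemovable lam z ∧ e ∣ j - content S z ∧ position e S j z = n := by
  obtain ⟨r, c, h1, h2⟩ := exists_removable_of_bend_profile (hlam _) h
  exact ⟨(r, c, parity n), (isRemovable_iff hlam).2 h2, position_eq he h1⟩

theorem exists_addable_of_signature {e : ℤ} (he : e ≠ 0) {S : Fin 2 → ℤ} {lam : Fin 2 → ℕ → ℕ}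
    (hlam : IsBipartition lam) {j n : ℤ} (h : signature e S lam j n = -1) :
    ∃ z, IsAddable lam z ∧ e ∣ j - content S z ∧ position e S j z = n := by
  obtain ⟨r, c, h1, h2⟩ := exists_addable_of_bend_profile (hlam _) h
  exact ⟨(r, c, parity n), (isAddable_iff hlam).2 h2, position_eq he h1⟩

/-- A corner is the last node of its row or the position just after it. -/
theorem IsCorner.bounds {lam : Fin 2 → ℕ → ℕ} (hlam : IsBipartition lam) {r c : ℕ} {a : Fin 2}
    (h : IsCorner lam (r, c, a)) :
    c ≤ lam a r ∧ lam a r ≤ c + 1 ∧ lam a (r + 1) ≤ c ∧ (r = 0 ∨ 0 < lam a (r - 1)) := by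
  rcases h with h | h
  · have h1 := (isRemovable_iff hlam).1 h
    have h2 := (hlam a).antitone (show r - 1 ≤ r by omega)
    omega
  · have h1 := (isAddable_iff hlam).1 h
    have h2 := (hlam a).1 r
    omega

theorem IsCorner.position_lt {e : ℤ} (he : 0 < e) {S : Fin 2 → ℤ} {lam : Fin 2 → ℕ → ℕ}
    (hlam : IsBipartition lam) (hsep : IsSeparated S lam) {j : ℤ} {z w : Node}
    (hz : IsCorner lam z) (hw : IsCorner lam w) (hzj : e ∣ j - content S z)
    (hwj : e ∣ j - content S w) (h : Above z w) : position e S j z < position e S j w := by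
  obtain ⟨r, c, a⟩ := z
  obtain ⟨r', c', a'⟩ := w
  have hz' := hz.bounds hlam
  have hw' := hw.bounds hlam
  obtain ⟨q, hq⟩ := hzj
  obtain ⟨q', hq'⟩ := hwj
  rw [position, position, hq, hq', Int.mul_ediv_cancel_left _ he.ne',
    Int.mul_ediv_cancel_left _ he.ne']
  rcases h with h | ⟨h, h'⟩
  · obtain ⟨n, hn, hn'⟩ := hsep
    simp only at h
    obtain rfl : a = 0 := by omega
    obtain rfl : a' = 1 := by omega
    have h1 := (hlam 1).antitone (Nat.zero_le r')
    have h2 : r ≤ n := by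
      by_contra! hc
      have := hn (r - 1) (by omega)
      omega
    have h3 : e * q ≤ e * q' := by
      simp only [content] at hq hq'
      omega
    have h4 := le_of_mul_le_mul_left h3 he
    simp
    omega
  · simp only at h h'
    subst h
    have h1 := (hlam a).antitone (show r + 1 ≤ r' by omega)
    have h3 : e * q < e * q' := by
      simp only [content] at hq hq'
      omega
    have h4 := lt_of_mul_lt_mul_left h3 he.le
    omega

theorem IsCorner.eq_or_above {e : ℤ} (he : 2 ≤ e) {S : Fin 2 → ℤ} {lam : Fin 2 → ℕ → ℕ}
    (hlam : IsBipartition lam) {j : ℤ} {z w : Node}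
    (hz : IsCorner lam z) (hw : IsCorner lam w) (hzj : e ∣ j - content S z)
    (hwj : e ∣ j - content S w) : z = w ∨ Above z w ∨ Above w z := by
  obtain ⟨r, c, a⟩ := z
  obtain ⟨r', c', a'⟩ := w
  rcases lt_trichotomy a a' with h | rfl | h
  · exact Or.inr (Or.inl (Or.inl h))
  · rcases lt_trichotomy r r' with h | rfl | h
    · exact Or.inr (Or.inl (Or.inr ⟨rfl, h⟩))
    · left
      have hz' := hz.bounds hlam
      have hw' := hw.bounds hlam
      have h1 := dvd_sub hzj hwj
      have h2 := Int.eq_zero_of_abs_lt_dvd h1 (by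
        simp only [content]
        rw [abs_lt]
        omega)
      simp only [content] at h2
      obtain rfl : c = c' := by omega
      rfl
    · exact Or.inr (Or.inr (Or.inr ⟨rfl, h⟩))
  · exact Or.inr (Or.inr (Or.inl h))

theorem IsCorner.above_iff {e : ℤ} (he : 2 ≤ e) {S : Fin 2 → ℤ} {lam : Fin 2 → ℕ → ℕ}
    (hlam : IsBipartition lam) (hsep : IsSeparated S lam) {j : ℤ} {z w : Node}
    (hz : IsCorner lam z) (hw : IsCorner lam w) (hzj : e ∣ j - content S z)
    (hwj : e ∣ j - content S w) : Above z w ↔ position e S j z < position e S j w := by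
  refine ⟨hz.position_lt (by omega) hlam hsep hw hzj hwj, fun h => ?_⟩
  rcases hz.eq_or_above he hlam hw hzj hwj with rfl | h1 | h1
  · omega
  · exact h1
  · have := hw.position_lt (by omega) hlam hsep hz hwj hzj h1
    omega

theorem IsCorner.eq_of_position_eq {e : ℤ} (he : 2 ≤ e) {S : Fin 2 → ℤ} {lam : Fin 2 → ℕ → ℕ}
    (hlam : IsBipartition lam) (hsep : IsSeparated S lam) {j : ℤ} {z w : Node}
    (hz : IsCorner lam z) (hw : IsCorner lam w) (hzj : e ∣ j - content S z)
    (hwj : e ∣ j - content S w) (h : position e S j z = position e S j w) : z = w := by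
  rcases hz.eq_or_above he hlam hw hzj hwj with h1 | h1 | h1
  · exact h1
  · have := (hz.above_iff he hlam hsep hw hzj hwj).1 h1
    omega
  · have := (hw.above_iff he hlam hsep hz hwj hzj).1 h1
    omega

/-- Counting the signs strictly between two given ones. -/
theorem ncard_between {e : ℕ} (he : 2 ≤ e) {κ : Fin 2 → ZMod e} {S : Fin 2 → ℤ}
    (hS : ∀ a, (S a : ZMod e) = κ a) {lam : Fin 2 → ℕ → ℕ} (hlam : IsBipartition lam)
    (hsep : IsSeparated S lam) {i : ZMod e} {j : ℤ} (hj : (j : ZMod e) = i)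
    {p : Node → Prop} (hp : ∀ z, p z → IsCorner lam z) {u : ℤ}
    (hu : ∀ z, p z → bend (profile (lam z.2.2) (S z.2.2)) (content S z) = u)
    (hu' : ∀ n, signature e S lam j n = u →
      ∃ z, p z ∧ (e : ℤ) ∣ j - content S z ∧ position e S j z = n)
    {x y : Node} (hx : IsCorner lam x) (hy : IsCorner lam y) (hxi : res e κ x = i)
    (hyi : res e κ y = i) :
    Set.ncard {n | signature e S lam j n = u ∧ position e S j x < n ∧ n < position e S j y} =
      Set.ncard {z | p z ∧ res e κ z = i ∧ Above x z ∧ Above z y} := by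
  have he' : (2 : ℤ) ≤ e := by exact_mod_cast he
  simp only [res_eq_iff_dvd hS hj] at hxi hyi ⊢
  rw [← Set.InjOn.ncard_image (f := position e S j)]
  · congr 1
    ext n
    simp only [Set.mem_ofPred_eq, Set.mem_image]
    constructor
    · rintro ⟨hn, h1, h2⟩
      obtain ⟨z, hz, hzj, rfl⟩ := hu' n hn
      exact ⟨z, ⟨hz, hzj, (hx.above_iff he' hlam hsep (hp z hz) hxi hzj).2 h1,
        ((hp z hz).above_iff he' hlam hsep hy hzj hyi).2 h2⟩, rfl⟩
    · rintro ⟨z, ⟨hz, hzj, h1, h2⟩, rfl⟩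
      exact ⟨by rw [signature_position lam hzj, hu z hz],
        (hx.above_iff he' hlam hsep (hp z hz) hxi hzj).1 h1,
        ((hp z hz).above_iff he' hlam hsep hy hzj hyi).1 h2⟩
  · rintro z ⟨hz, hzj, -⟩ w ⟨hw, hwj, -⟩ h
    exact (hp z hz).eq_of_position_eq he' hlam hsep (hp w hw) hzj hwj h

theorem isNormal_iff_isNormalSign {e : ℕ} (he : 2 ≤ e) {κ : Fin 2 → ZMod e} {S : Fin 2 → ℤ}
    (hS : ∀ a, (S a : ZMod e) = κ a) {lam : Fin 2 → ℕ → ℕ} (hlam : IsBipartition lam)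
    (hsep : IsSeparated S lam) {i : ZMod e} {j : ℤ} (hj : (j : ZMod e) = i) {x : Node}
    (hx : IsRemovable lam x) (hxi : res e κ x = i) :
    IsNormal e κ lam i x ↔ IsNormalSign (signature e S lam j) (position e S j x) := by
  have he' : (2 : ℤ) ≤ e := by exact_mod_cast he
  have hxj := (res_eq_iff_dvd hS hj x).1 hxi
  have hrem : ∀ y, IsAddable lam y → res e κ y = i → _ := fun y hy hyi =>
    ncard_between he hS hlam hsep hj (p := IsRemovable lam) (fun _ => Or.inl)
      (fun z hz => hz.bend_eq hlam S)
      (fun n hn => exists_removable_of_signature (by omega) hlam hn) (Or.inl hx) (Or.inr hy) hxi hyi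
  have hadd : ∀ y, IsAddable lam y → res e κ y = i → _ := fun y hy hyi =>
    ncard_between he hS hlam hsep hj (p := IsAddable lam) (fun _ => Or.inr)
      (fun z hz => hz.bend_eq hlam S)
      (fun n hn => exists_addable_of_signature (by omega) hlam hn) (Or.inl hx) (Or.inr hy) hxi hyi
  rw [IsNormal, IsNormalSign, signature_position lam hxj, hx.bend_eq hlam S]
  refine ⟨fun h => ⟨rfl, fun n hn hxn => ?_⟩, fun h => ⟨hx, hxi, fun y hy hyi hxy => ?_⟩⟩
  · obtain ⟨y, hy, hyj, rfl⟩ := exists_addable_of_signature (by omega) hlam hn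
    have hyi := (res_eq_iff_dvd hS hj y).2 hyj
    rw [hrem y hy hyi, hadd y hy hyi]
    exact h.2.2 y hy hyi
      ((IsCorner.above_iff he' hlam hsep (Or.inl hx) (Or.inr hy) hxj hyj).2 hxn)
  · have hyj := (res_eq_iff_dvd hS hj y).1 hyi
    rw [← hrem y hy hyi, ← hadd y hy hyi]
    exact h.2 _ (by rw [signature_position lam hyj, hy.bend_eq hlam S])
      ((IsCorner.above_iff he' hlam hsep (Or.inl hx) (Or.inr hy) hxj hyj).1 hxy)

/-- The pair of profiles of a bipartition. -/
noncomputable def profiles (S : Fin 2 → ℤ) (lam : Fin 2 → ℕ → ℕ) : ProfilePair :=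
  (profile (lam 0) (S 0), profile (lam 1) (S 1))

theorem RemGood.move {e : ℕ} (he : 2 ≤ e) {κ : Fin 2 → ZMod e} {S : Fin 2 → ℤ}
    (hS : ∀ a, (S a : ZMod e) = κ a) {mu lam : Fin 2 → ℕ → ℕ} (hsep : IsSeparated S lam)
    (h : RemGood e κ mu lam) : Move e (profiles S lam) (profiles S mu) := by
  obtain ⟨hmu, hlam, i, x, ⟨hx, hmin⟩, hdiag⟩ := h
  have he' : (2 : ℤ) ≤ e := by exact_mod_cast he
  set j := content S x with hj_def
  have hxj : (e : ℤ) ∣ j - content S x := by simp [hj_def]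
  have hj : (j : ZMod e) = i := by
    have := (res_eq_iff_dvd hS (i := (j : ZMod e)) rfl x).2 hxj
    rw [← this, hx.2.1]
  have hsign := (isNormal_iff_isNormalSign he hS hlam hsep hj hx.1 hx.2.1).1 hx
  obtain ⟨P, hP, hbefore, hafter⟩ :=
    exists_partial_sum_of_good (signature_mem hlam e S j) hsign fun n hn => by
      obtain ⟨y, hy, hyj, rfl⟩ := exists_removable_of_signature (by omega) hlam hn.1
      have hyi := (res_eq_iff_dvd hS hj y).2 hyj
      rcases hmin y ((isNormal_iff_isNormalSign he hS hlam hsep hj hy hyi).2 hn) with rfl | h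
      · exact le_rfl
      · exact ((IsCorner.above_iff he' hlam hsep (Or.inl hx.1) (Or.inl hy) hxj hyj).1 h).le
  have hheight : IsHeight e (profile (lam 0) (S 0)) (profile (lam 1) (S 1)) j
      (fun t => P (2 * t)) (fun t => P (2 * t + 1)) := by
    constructor
    · intro t
      have h1 := parity_two_mul_add t 0
      have h2 := two_mul_add_ediv_two t 0
      simp only [Fin.val_zero, Nat.cast_zero, add_zero] at h1 h2
      simp only [hP, signature, h1, h2]
    · intro t
      have h1 := parity_two_mul_add t 1
      have h2 := two_mul_add_ediv_two t 1
      simp only [Fin.val_one, Nat.cast_one] at h1 h2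
      have h3 := hP (2 * t + 1)
      simp only [signature, h1, h2] at h3
      rw [← h3]
      congr 1
      ring
  refine ⟨⟨isProfile_profile (hlam 0) _, isProfile_profile (hlam 1) _⟩,
    ⟨isProfile_profile (hmu 0) _, isProfile_profile (hmu 1) _⟩, ?_⟩
  obtain ⟨r, c, a⟩ := x
  obtain ⟨h1, h2, h3⟩ := apply_of_diagram_eq hdiag hx.1.1
  have hupd := profile_remove (hlam a) (hmu a) (S a) h1 h2 fun k hk => h3 k a (by simp [hk])
  have hpos : position e S j (r, c, a) = (a : ℕ) := by
    simp [position, hj_def]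
  rw [hpos] at hbefore hafter
  fin_cases a
  · refine Or.inl ⟨j, _, _, hheight, ?_⟩
    simp only [Nat.cast_zero] at hbefore hafter
    refine ⟨fun t ht => hbefore _ (by omega), fun t ht => hbefore _ (by omega),
      fun t ht => hafter _ (by omega), fun t ht => hafter _ (by omega), ?_⟩
    have h4 : mu 1 = lam 1 := funext fun k => h3 k 1 (by simp)
    exact Prod.ext hupd (by simp [profiles, h4])
  · refine Or.inr ⟨j, _, _, hheight, ?_⟩
    simp only [Nat.cast_one] at hbefore hafter
    refine ⟨fun t ht => hbefore _ (by omega), fun t ht => hbefore _ (by omega),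
      fun t ht => hafter _ (by omega), fun t ht => hafter _ (by omega), ?_⟩
    have h4 : mu 0 = lam 0 := funext fun k => h3 k 0 (by simp)
    exact Prod.ext (by simp [profiles, h4]) hupd

theorem eqvGen_move_of_eqvGen_remGood {e : ℕ} (he : 2 ≤ e) {κ : Fin 2 → ZMod e}
    {lam mu : Fin 2 → ℕ → ℕ} (h : Relation.EqvGen (RemGood e κ) lam mu) :
    ∃ d : ℤ, ∀ S : Fin 2 → ℤ, (∀ a, (S a : ZMod e) = κ a) → d ≤ S 0 - S 1 →
      Relation.EqvGen (Move e) (profiles S lam) (profiles S mu) := by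
  induction h with
  | rel mu lam h =>
    obtain ⟨n, hn⟩ := (h.2.1 0).2
    exact ⟨n + lam 1 0, fun S hS hd =>
      .symm _ _ (.rel _ _ (h.move he hS ⟨n, hn, by omega⟩))⟩
  | refl lam => exact ⟨0, fun _ _ _ => .refl _⟩
  | symm lam mu _ ih =>
    obtain ⟨d, hd⟩ := ih
    exact ⟨d, fun S hS h => .symm _ _ (hd S hS h)⟩
  | trans lam mu nu _ _ ih₁ ih₂ =>
    obtain ⟨d₁, h₁⟩ := ih₁
    obtain ⟨d₂, h₂⟩ := ih₂
    exact ⟨max d₁ d₂, fun S hS h => .trans _ _ _ (h₁ S hS ((le_max_left _ _).trans h))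
      (h₂ S hS ((le_max_right _ _).trans h))⟩

theorem exists_lift {e : ℕ} (he : 0 < e) (κ : Fin 2 → ZMod e) (d : ℤ) :
    ∃ S : Fin 2 → ℤ, (∀ a, (S a : ZMod e) = κ a) ∧ d ≤ S 0 - S 1 := by
  obtain ⟨s, hs⟩ := ZMod.intCast_surjective (κ 0)
  obtain ⟨t, ht⟩ := ZMod.intCast_surjective (κ 1)
  refine ⟨![s, t - e * |d + t - s|], fun a => ?_, ?_⟩
  · fin_cases a <;> simp [hs, ht]
  · have h1 : |d + t - s| ≤ e * |d + t - s| :=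
      le_mul_of_one_le_left (abs_nonneg _) (by exact_mod_cast he)
    have h2 := le_abs_self (d + t - s)
    simp
    omega

theorem res_eq_res_iff {e : ℕ} {κ : Fin 2 → ZMod e} {S : Fin 2 → ℤ}
    (hS : ∀ a, (S a : ZMod e) = κ a) (z w : Node) :
    res e κ z = res e κ w ↔ (e : ℤ) ∣ content S w - content S z :=
  res_eq_iff_dvd hS ((res_eq_iff_dvd hS rfl w).2 (by simp)).symm z

theorem finite_removable_between (lam : Fin 2 → ℕ → ℕ) (hlam : IsBipartition lam) (x y : Node)
    (p : Node → Prop) (hxy : x.2.2 = y.2.2) :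
    {z | IsRemovable lam z ∧ p z ∧ Above x z ∧ Above z y}.Finite := by
  refine ((Set.finite_Iic y.1).image fun k => ((k, lam y.2.2 k - 1, y.2.2) : Node)).subset ?_
  rintro ⟨r, c, a⟩ ⟨hz, -, h1, h2⟩
  have h3 := (isRemovable_iff hlam).1 hz
  simp only [Above] at h1 h2
  obtain rfl : a = y.2.2 := by omega
  refine ⟨r, ?_, ?_⟩
  · simp only [Set.mem_Iic]
    omega
  · simp only [Prod.mk.injEq, true_and, and_true]
    omega

theorem RemGood.isERestricted {e : ℕ} (he : 2 ≤ e) {κ : Fin 2 → ZMod e}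
    {mu lam : Fin 2 → ℕ → ℕ} (h : RemGood e κ mu lam) (hr : IsERestricted e (lam 1)) :
    IsERestricted e (mu 1) := by
  obtain ⟨S, hS, -⟩ := exists_lift (by omega) κ 0
  obtain ⟨hmu, hlam, i, ⟨r, c, a⟩, ⟨⟨hx, rfl, hx'⟩, hmin⟩, hdiag⟩ := h
  obtain ⟨h1, h2, h3⟩ := apply_of_diagram_eq hdiag hx.1
  obtain rfl | rfl : a = 0 ∨ a = 1 := by omega
  · rwa [show mu 1 = lam 1 from funext fun k => h3 k 1 (by simp)]
  intro k
  by_contra! hcon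
  have hrk := hr k
  obtain rfl : k + 1 = r := by
    by_contra hk
    rw [h3 (k + 1) 1 (by simp [hk])] at hcon
    rcases eq_or_ne k r with rfl | hkr
    · omega
    · rw [h3 k 1 (by simp [hkr])] at hcon
      omega
  rw [h3 k 1 (by simp), h2] at hcon
  have hrow : ∀ w : Node, IsAddable lam w → res e κ w = res e κ (k + 1, c, 1) →
      Above (k, c + e - 1, 1) w → Above (k + 1, c, 1) w := by
    rintro ⟨r', c', a'⟩ hw hwi h
    have hw' := (isAddable_iff hlam).1 hw
    simp only [Above] at h ⊢
    obtain rfl : a' = 1 := by omega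
    rcases eq_or_ne r' (k + 1) with rfl | hne
    · rw [res_eq_res_iff hS] at hwi
      have := Int.eq_zero_of_abs_lt_dvd hwi (by
        simp only [content]
        rw [abs_lt]
        omega)
      simp only [content] at this
      omega
    · omega
  have hy : IsNormal e κ lam (res e κ (k + 1, c, 1)) (k, c + e - 1, 1) := by
    refine ⟨(isRemovable_iff hlam).2 (by omega), ?_, fun z hz hzi hyz => ?_⟩
    · rw [res_eq_res_iff hS]
      refine ⟨-1, ?_⟩
      simp only [content]
      omega
    · have hxz := hrow z hz hzi hyz
      refine (lt_of_eq_of_lt ?_ (hx' z hz hzi hxz)).trans_le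
        (Set.ncard_le_ncard ?_ (finite_removable_between lam hlam _ _ _ ?_))
      · congr 1
        ext w
        simp only [Set.mem_ofPred_eq]
        refine ⟨fun h => ⟨h.1, h.2.1, hrow w h.1 h.2.1 h.2.2.1, h.2.2.2⟩, fun h => ⟨h.1, h.2.1, ?_,
          h.2.2.2⟩⟩
        have := h.2.2.1
        simp only [Above] at this ⊢
        omega
      · rintro w ⟨hw, hwi, h, h'⟩
        refine ⟨hw, hwi, ?_, h'⟩
        simp only [Above] at h ⊢
        omega
      · simp only [Above] at hyz ⊢
        omega
  rcases hmin _ hy with h | h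
  · simp at h
  · simp [Above] at h

theorem RemGood.isERestricted_symm {e : ℕ} (he : 2 ≤ e) {κ : Fin 2 → ZMod e}
    {mu lam : Fin 2 → ℕ → ℕ} (h : RemGood e κ mu lam) (hr : IsERestricted e (mu 1)) :
    IsERestricted e (lam 1) := by
  obtain ⟨S, hS, -⟩ := exists_lift (by omega) κ 0
  obtain ⟨hmu, hlam, i, ⟨r, c, a⟩, ⟨⟨hx, rfl, hx'⟩, -⟩, hdiag⟩ := h
  obtain ⟨h1, h2, h3⟩ := apply_of_diagram_eq hdiag hx.1
  obtain rfl | rfl : a = 0 ∨ a = 1 := by omega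
  · rwa [show lam 1 = mu 1 from funext fun k => (h3 k 1 (by simp)).symm]
  intro k
  by_contra! hcon
  have hrk := hr k
  obtain rfl : k = r := by
    by_contra hk
    rw [h3 k 1 (by simp [hk])] at hrk
    rcases eq_or_ne (k + 1) r with rfl | hkr
    · omega
    · rw [h3 (k + 1) 1 (by simp [hkr])] at hrk
      omega
  rw [h3 (k + 1) 1 (by simp), h2] at hrk
  have hlt := hx' (k + 1, lam 1 (k + 1), 1)
    ((isAddable_iff hlam).2 ⟨rfl, Or.inr (by simp only [add_tsub_cancel_right]; omega)⟩)
    (by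
      rw [res_eq_res_iff hS]
      refine ⟨1, ?_⟩
      simp only [content]
      omega)
    (Or.inr ⟨rfl, by simp⟩)
  have hempty : {z | IsRemovable lam z ∧ res e κ z = res e κ (k, c, 1) ∧ Above (k, c, 1) z ∧
      Above z (k + 1, lam 1 (k + 1), 1)} = ∅ := by
    refine Set.eq_empty_iff_forall_notMem.2 fun z hz => ?_
    obtain ⟨-, -, h4, h5⟩ := hz
    simp only [Above] at h4 h5
    omega
  rw [hempty, Set.ncard_empty] at hlt
  omega

theorem isERestricted_iff_of_eqvGen {e : ℕ} (he : 2 ≤ e) {κ : Fin 2 → ZMod e}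
    {lam mu : Fin 2 → ℕ → ℕ} (h : Relation.EqvGen (RemGood e κ) lam mu) :
    IsERestricted e (lam 1) ↔ IsERestricted e (mu 1) := by
  induction h with
  | rel _ _ h => exact ⟨h.isERestricted_symm he, h.isERestricted he⟩
  | refl _ => rfl
  | symm _ _ _ ih => exact ih.symm
  | trans _ _ _ _ _ ih₁ ih₂ => exact ih₁.trans ih₂

theorem IsPartition.exists_last_row {f : ℕ → ℕ} (hf : IsPartition f) (h : f ≠ fun _ => 0) :
    ∃ r, 0 < f r ∧ ∀ k, r < k → f k = 0 := by
  classical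
  obtain ⟨N, hN⟩ := hf.2
  have hex : ∃ n, f n = 0 := ⟨N, hN N le_rfl⟩
  have hzero : ∀ k, Nat.find hex ≤ k → f k = 0 := fun k hk =>
    Nat.eq_zero_of_le_zero ((hf.antitone hk).trans (Nat.find_spec hex).le)
  have hpos : Nat.find hex ≠ 0 := fun h0 => h (funext fun k => hzero k (by omega))
  refine ⟨Nat.find hex - 1, Nat.pos_of_ne_zero (Nat.find_min hex (by omega)), fun k hk =>
    hzero k (by omega)⟩

theorem isNormal_of_forall_addable {e : ℕ} {κ : Fin 2 → ZMod e} {S : Fin 2 → ℤ}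
    (hS : ∀ a, (S a : ZMod e) = κ a) {lam : Fin 2 → ℕ → ℕ} {x : Node} (hx : IsRemovable lam x)
    (h : ∀ y, IsAddable lam y → Above x y →
      content S y < content S x ∧ content S x < content S y + e ∨
        ∃ t, (e : ℤ) ∣ t - content S y ∧ t < content S x ∧ content S x < t + e) :
    IsNormal e κ lam (res e κ x) x := by
  refine ⟨hx, rfl, fun y hy hyi hxy => ?_⟩
  rw [res_eq_res_iff hS] at hyi
  exfalso
  obtain ⟨t, ht, h1, h2⟩ : ∃ t, (e : ℤ) ∣ t - content S y ∧ t < content S x ∧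
      content S x < t + e := by
    rcases h y hy hxy with h | h
    · exact ⟨content S y, by simp, h⟩
    · exact h
  have h3 := dvd_sub hyi ht
  rw [sub_sub_sub_cancel_right] at h3
  have := Int.le_of_dvd (by omega) h3
  omega

theorem snd_eq_zero_of_no_normal {e : ℕ} (he : 2 ≤ e) {κ : Fin 2 → ZMod e}
    {lam : Fin 2 → ℕ → ℕ} (hlam : IsBipartition lam) (hr : IsERestricted e (lam 1))
    (hnorm : ∀ (i : ZMod e) (x : Node), ¬ IsNormal e κ lam i x) : lam 1 = fun _ => 0 := by
  obtain ⟨S, hS, -⟩ := exists_lift (by omega) κ 0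
  by_contra hne
  obtain ⟨r, hpos, hzero⟩ := (hlam 1).exists_last_row hne
  refine hnorm _ (r, lam 1 r - 1, 1) (isNormal_of_forall_addable hS ?_ ?_)
  · have := hzero (r + 1) (by omega)
    exact (isRemovable_iff hlam).2 (by omega)
  · rintro ⟨r', c', a'⟩ hy hxy
    have hy' := (isAddable_iff hlam).1 hy
    have h0 := hr r
    have h1 := hzero (r + 1) (by omega)
    have h2 := hzero (r' - 1)
    have h3 := hzero r'
    simp only [Above] at hxy
    obtain rfl : a' = 1 := by omega
    simp only [content]
    omega

theorem fst_eq_zero_of_no_normal {e : ℕ} (he : 2 ≤ e) {κ : Fin 2 → ZMod e}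
    {lam : Fin 2 → ℕ → ℕ} (hlam : IsBipartition lam) (hres : IsRestricted e κ lam)
    (hsnd : lam 1 = fun _ => 0)
    (hnorm : ∀ (i : ZMod e) (x : Node), ¬ IsNormal e κ lam i x) : lam 0 = fun _ => 0 := by
  obtain ⟨d, hd⟩ := eqvGen_move_of_eqvGen_remGood he hres
  obtain ⟨S, hS, hdS⟩ := exists_lift (by omega) κ (max d 0)
  have hmove := hd S hS ((le_max_left _ _).trans hdS)
  have hS' := (le_max_right _ _).trans hdS
  simp only [profiles, hsnd, profile_zero] at hmove
  obtain ⟨t, hdvd, h1, h2, h3, h4⟩ := exists_window (by omega) (isProfile_profile (hlam 0) (S 0))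
    (profile_le_vacuum (hlam 0) (S 0)) (S 0 - S 1 + 1).toNat (S 1) (by omega) (by omega) hmove
  by_contra hne
  obtain ⟨r, hpos, hzero⟩ := (hlam 0).exists_last_row hne
  have hX : lam 0 r - 1 - r + S 0 < t + e := by
    by_contra! hX
    obtain ⟨n, k1, k2, k3⟩ := exists_profile_eq (hlam 0) (S 0) (lam 0 r - 1 - r + S 0)
    rw [h4 _ hX] at k1
    have := (hlam 0).antitone (show n ≤ r by omega)
    omega
  have hY : t < S 0 - r := by
    by_contra! hY
    obtain ⟨n, k1, k2, k3⟩ := exists_profile_eq (hlam 0) (S 0) (S 0 - r)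
    rw [h3 _ hY] at k1
    obtain rfl : n = r := by omega
    omega
  refine hnorm _ (r, lam 0 r - 1, 0) (isNormal_of_forall_addable hS ?_ ?_)
  · have := hzero (r + 1) (by omega)
    exact (isRemovable_iff hlam).2 (by omega)
  · rintro ⟨r', c', a'⟩ hy hxy
    have hy' := (isAddable_iff hlam).1 hy
    simp only [Above] at hxy
    obtain rfl | rfl : a' = 0 ∨ a' = 1 := by omega
    · left
      have h5 := hzero (r' - 1)
      have h6 := hzero r'
      simp only [content]
      omega
    · right
      simp only [hsnd] at hy'
      have h7 : content S (r', c', 1) = S 1 := by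
        simp only [content]
        omega
      refine ⟨t, by rwa [h7], ?_⟩
      simp only [content]
      omega

/-! The statement. -/

theorem stmt18 (e : ℕ) (he : 2 ≤ e) (κ : Fin 2 → ZMod e) (lam : Fin 2 → ℕ → ℕ)
    (hlam : IsBipartition lam) (hres : IsRestricted e κ lam)
    (hnorm : ∀ (i : ZMod e) (x : Node), ¬ IsNormal e κ lam i x) :
    lam = fun _ _ => 0 := by
  have hsnd := snd_eq_zero_of_no_normal he hlam
    ((isERestricted_iff_of_eqvGen he hres).2 fun _ => by simp only; omega) hnorm
  have hfst := fst_eq_zero_of_no_normal he hlam hres hsnd hnorm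
  funext a
  fin_cases a
  · exact hfst
  · exact hsnd

end Wt3
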